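/- Assume N ≥ 5, hypotheses (V), (K) with s > 2N/(N+4), and (Q), and suppose there exist q₁, q₂ > 1 such that (f_{q₁,q₂}) holds and (R'_{q₁,q₂}) holds, i.e. there exist R₁, R₂ > 0 with R₀(q₁,R₁) < ∞ and R_∞(q₂,R₂) < ∞. Then every critical point of the restriction of the functional I to H²_{V,r}(ℝ^N) (i.e. every u ∈ H²_{V,r} with I'(u)h = 0 for all h ∈ H²_{V,r}) is a radial weak solution of Δ²u + V(|x|)u = K(|x|)f(u) + Q(|x|) in ℝ^N, i.e. the weak formulation holds for all test functions h in the full space H²_V. -/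

import Mathlib

open MeasureTheory Filter Topology Set ENNReal

noncomputable section

/-- Euclidean space `ℝ^N`. -/
abbrev E (N : ℕ) := EuclideanSpace ℝ (Fin N)

/-- The (classical) Laplacian of a function `φ : ℝ^N → ℝ`. -/
def lapl {N : ℕ} (φ : E N → ℝ) (x : E N) : ℝ :=
  ∑ i : Fin N, fderiv ℝ (fun y => fderiv ℝ φ y (EuclideanSpace.single i 1)) x
    (EuclideanSpace.single i 1)

/-- A function is radial if it depends only on the norm. -/
def IsRadial {N : ℕ} (u : E N → ℝ) : Prop := ∀ x y : E N, ‖x‖ = ‖y‖ → u x = u y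

/-- The critical exponent `2** = 2N/(N-4)` as an element of `ℝ≥0∞`. -/
def twoSS (N : ℕ) : ℝ≥0∞ := (2 * N : ℝ≥0∞) / ((N : ℝ≥0∞) - 4)

/-- `u ∈ D^{2,2}(ℝ^N)` with (distributional) Laplacian `w`: `u` lies in `L^{2**}`,
`w ∈ L²`, and `u` is the limit in `L^{2**}` of smooth compactly supported functions whose
Laplacians converge to `w` in `L²` (i.e. `u` lies in the closure of `C_c^∞` for the norm
`‖Δ·‖_{L²}`, with `Δu = w`). -/
def MemD22 (N : ℕ) (u w : E N → ℝ) : Prop :=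
  MemLp u (twoSS N) volume ∧ MemLp w 2 volume ∧
  ∃ φ : ℕ → E N → ℝ,
    (∀ n, ContDiff ℝ (⊤ : ℕ∞) (φ n) ∧ HasCompactSupport (φ n)) ∧
    Tendsto (fun n => eLpNorm (fun x => φ n x - u x) (twoSS N) volume) atTop (𝓝 0) ∧
    Tendsto (fun n => eLpNorm (fun x => lapl (φ n) x - w x) 2 volume) atTop (𝓝 0)

/-- `u ∈ H²_V(ℝ^N)` (with Laplacian `w`). -/
def MemH2V {N : ℕ} (V : ℝ → ℝ≥0∞) (u w : E N → ℝ) : Prop :=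
  MemD22 N u w ∧ (∫⁻ x : E N, V ‖x‖ * ENNReal.ofReal ((u x) ^ 2)) < ⊤

/-- `u ∈ H²_{V,r}(ℝ^N)`: member of `H²_V` which is radial. -/
def MemH2Vr {N : ℕ} (V : ℝ → ℝ≥0∞) (u w : E N → ℝ) : Prop :=
  MemH2V V u w ∧ IsRadial u

/-- The norm of `H²_V`: `‖u‖ = (∫ |Δu|² + V(|x|)u²)^{1/2}` (here `w = Δu`). -/
def H2norm {N : ℕ} (V : ℝ → ℝ≥0∞) (u w : E N → ℝ) : ℝ :=
  (((∫⁻ x : E N, ENNReal.ofReal ((w x) ^ 2)) +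
    ∫⁻ x : E N, V ‖x‖ * ENNReal.ofReal ((u x) ^ 2)).toReal) ^ (1/2 : ℝ)

/-- Hypothesis (V): `V : (0,∞) → [0,∞]` measurable and locally integrable on `(0,∞)`. -/
def HypV (V : ℝ → ℝ≥0∞) : Prop :=
  Measurable V ∧ ∀ a b : ℝ, 0 < a → (∫⁻ r in Set.Icc a b, V r) < ⊤

/-- Hypothesis (K): `K : (0,∞) → (0,∞)` measurable with `K ∈ L^s_loc((0,∞))`. -/
def HypK (K : ℝ → ℝ) (s : ℝ) : Prop :=
  (∀ r : ℝ, 0 < r → 0 < K r) ∧ Measurable K ∧ 1 < s ∧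
  ∀ a b : ℝ, 0 < a → IntegrableOn (fun r => K r ^ s) (Set.Icc a b) volume

/-- The quantity `S₀(q,R)`. -/
def S0 (N : ℕ) (V : ℝ → ℝ≥0∞) (K : ℝ → ℝ) (q R : ℝ) : ℝ≥0∞ :=
  ⨆ p : {p : (E N → ℝ) × (E N → ℝ) // MemH2Vr V p.1 p.2 ∧ H2norm V p.1 p.2 = 1},
    ∫⁻ x in Metric.ball (0 : E N) R, ENNReal.ofReal (K ‖x‖ * |p.1.1 x| ^ q)

/-- The quantity `S_∞(q,R)`. -/
def Sinf (N : ℕ) (V : ℝ → ℝ≥0∞) (K : ℝ → ℝ) (q R : ℝ) : ℝ≥0∞ :=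
  ⨆ p : {p : (E N → ℝ) × (E N → ℝ) // MemH2Vr V p.1 p.2 ∧ H2norm V p.1 p.2 = 1},
    ∫⁻ x in (Metric.ball (0 : E N) R)ᶜ, ENNReal.ofReal (K ‖x‖ * |p.1.1 x| ^ q)

/-- The quantity `R₀(q,R)`. -/
def R0 (N : ℕ) (V : ℝ → ℝ≥0∞) (K : ℝ → ℝ) (q R : ℝ) : ℝ≥0∞ :=
  ⨆ p : {p : ((E N → ℝ) × (E N → ℝ)) × ((E N → ℝ) × (E N → ℝ)) //
      MemH2Vr V p.1.1 p.1.2 ∧ MemH2Vr V p.2.1 p.2.2 ∧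
      H2norm V p.1.1 p.1.2 = 1 ∧ H2norm V p.2.1 p.2.2 = 1},
    ∫⁻ x in Metric.ball (0 : E N) R,
      ENNReal.ofReal (K ‖x‖ * |p.1.1.1 x| ^ (q - 1) * |p.1.2.1 x|)

/-- The quantity `R_∞(q,R)`. -/
def Rinf (N : ℕ) (V : ℝ → ℝ≥0∞) (K : ℝ → ℝ) (q R : ℝ) : ℝ≥0∞ :=
  ⨆ p : {p : ((E N → ℝ) × (E N → ℝ)) × ((E N → ℝ) × (E N → ℝ)) //
      MemH2Vr V p.1.1 p.1.2 ∧ MemH2Vr V p.2.1 p.2.2 ∧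
      H2norm V p.1.1 p.1.2 = 1 ∧ H2norm V p.2.1 p.2.2 = 1},
    ∫⁻ x in (Metric.ball (0 : E N) R)ᶜ,
      ENNReal.ofReal (K ‖x‖ * |p.1.1.1 x| ^ (q - 1) * |p.1.2.1 x|)

/-- The weighted measure `K(|x|)dx`. -/
def Kmeas (N : ℕ) (K : ℝ → ℝ) : Measure (E N) :=
  volume.withDensity (fun x => ENNReal.ofReal (K ‖x‖))

/-- Membership in the sum space `L^{q₁}_K + L^{q₂}_K`. -/
def MemSum (N : ℕ) (K : ℝ → ℝ) (q1 q2 : ℝ) (u : E N → ℝ) : Prop :=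
  ∃ u1 u2 : E N → ℝ, u = u1 + u2 ∧ MemLp u1 (ENNReal.ofReal q1) (Kmeas N K) ∧
    MemLp u2 (ENNReal.ofReal q2) (Kmeas N K)

/-- The norm of the sum space `L^{q₁}_K + L^{q₂}_K`. -/
def sumNorm (N : ℕ) (K : ℝ → ℝ) (q1 q2 : ℝ) (u : E N → ℝ) : ℝ≥0∞ :=
  ⨅ p : {p : (E N → ℝ) × (E N → ℝ) // u = p.1 + p.2},
    max (eLpNorm p.1.1 (ENNReal.ofReal q1) (Kmeas N K))
        (eLpNorm p.1.2 (ENNReal.ofReal q2) (Kmeas N K))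

/-- `σ_N`, the (N-1)-dimensional measure of the unit sphere, i.e. `N·ω_N`. -/
def sigmaN (N : ℕ) : ℝ := N * (volume (Metric.ball (0 : E N) 1)).toReal

end

noncomputable section

/-- `F(t) = ∫₀ᵗ f(s) ds`. -/
def Fint (f : ℝ → ℝ) (t : ℝ) : ℝ := ∫ s in (0:ℝ)..t, f s

/-- Hypothesis `(f_{q₁,q₂})`: `|f(t)| ≤ M min{t^{q₁-1}, t^{q₂-1}}` for all `t ≥ 0`. -/
def Hypf (f : ℝ → ℝ) (q1 q2 : ℝ) : Prop :=
  ∃ M > (0:ℝ), ∀ t : ℝ, 0 ≤ t → |f t| ≤ M * min (t ^ (q1 - 1)) (t ^ (q2 - 1))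

/-- Hypothesis `(Q)`: `Q ≥ 0` on `(0,∞)`, measurable, and `h ↦ ∫ Q(|x|)h dx` is a
continuous linear functional on `H²_V`. -/
def HypQ (N : ℕ) (V : ℝ → ℝ≥0∞) (Q : ℝ → ℝ) : Prop :=
  Measurable Q ∧ (∀ r : ℝ, 0 < r → 0 ≤ Q r) ∧
  ∃ L ≥ (0:ℝ), ∀ h z : E N → ℝ, MemH2V V h z →
    Integrable (fun x => Q ‖x‖ * h x) ∧ |∫ x, Q ‖x‖ * h x| ≤ L * H2norm V h z

/-- The weak-formulation identity, tested against `h ∈ H²_V` (with Laplacian `z`):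
`∫ Δu Δh + ∫ V(|x|)u h = ∫ K(|x|)f(u)h + ∫ Q(|x|)h`, all integrals being finite. -/
def EulerEq (N : ℕ) (V : ℝ → ℝ≥0∞) (K Q f : ℝ → ℝ) (u w h z : E N → ℝ) : Prop :=
  Integrable (fun x => w x * z x) ∧
  Integrable (fun x => (V ‖x‖).toReal * u x * h x) ∧
  Integrable (fun x => K ‖x‖ * f (u x) * h x) ∧
  Integrable (fun x => Q ‖x‖ * h x) ∧
  (∫ x, w x * z x) + (∫ x, (V ‖x‖).toReal * u x * h x)
    = (∫ x, K ‖x‖ * f (u x) * h x) + ∫ x, Q ‖x‖ * h x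

/-- `u` (with Laplacian `w`) is a radial weak solution of
`Δ²u + V(|x|)u = K(|x|)f(u) + Q(|x|)` in `ℝ^N`. -/
def IsWeakSolution (N : ℕ) (V : ℝ → ℝ≥0∞) (K Q f : ℝ → ℝ) (u w : E N → ℝ) : Prop :=
  MemH2Vr V u w ∧ ∀ h z : E N → ℝ, MemH2V V h z → EulerEq N V K Q f u w h z

/-- Condition `(R''_{q₁,q₂})`. -/
def Rcond (N : ℕ) (V : ℝ → ℝ≥0∞) (K : ℝ → ℝ) (q1 q2 : ℝ) : Prop :=
  Tendsto (fun R => R0 N V K q1 R) (𝓝[>] (0:ℝ)) (𝓝 0) ∧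
  Tendsto (fun R => Rinf N V K q2 R) atTop (𝓝 0)

/-- The Euler functional `I(u) = ½‖u‖² - ∫ K(|x|)F(u) dx - ∫ Q(|x|)u dx`. -/
def EulerI (N : ℕ) (V : ℝ → ℝ≥0∞) (K Q f : ℝ → ℝ) (u w : E N → ℝ) : ℝ :=
  (1/2) * H2norm V u w ^ (2:ℕ) - (∫ x, K ‖x‖ * Fint f (u x)) - ∫ x, Q ‖x‖ * u x

end

noncomputable section

/-- Partial derivative. -/
def pd {N : ℕ} (i : Fin N) (φ : E N → ℝ) (x : E N) : ℝ :=
  fderiv ℝ φ x (EuclideanSpace.single i 1)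

/-- Test functions. -/
def TF {N : ℕ} (φ : E N → ℝ) : Prop := ContDiff ℝ (⊤ : ℕ∞) φ ∧ HasCompactSupport φ

/-- Test functions vanishing near zero. -/
def TF0 {N : ℕ} (φ : E N → ℝ) : Prop := TF φ ∧ ∃ δ > (0 : ℝ), ∀ x, ‖x‖ < δ → φ x = 0

lemma lapl_eq {N : ℕ} (φ : E N → ℝ) (x : E N) : lapl φ x = ∑ i, pd i (pd i φ) x := rfl

lemma contDiff_pd {N : ℕ} {φ : E N → ℝ} (h : ContDiff ℝ (⊤ : ℕ∞) φ) (i : Fin N) :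
    ContDiff ℝ (⊤ : ℕ∞) (pd i φ) := by
  have : ContDiff ℝ (⊤ : ℕ∞) (fderiv ℝ φ) := h.fderiv_right (by simp)
  exact this.clm_apply contDiff_const

lemma TF.pd {N : ℕ} {φ : E N → ℝ} (h : TF φ) (i : Fin N) : TF (pd i φ) :=
  ⟨contDiff_pd h.1 i, h.2.fderiv_apply (𝕜 := ℝ) _⟩

lemma pd_zero_near {N : ℕ} {φ : E N → ℝ} {δ : ℝ} (h : ∀ x, ‖x‖ < δ → φ x = 0) (i : Fin N) :
    ∀ x, ‖x‖ < δ → pd i φ x = 0 := by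
  intro x hx
  have : φ =ᶠ[𝓝 x] fun _ => 0 := by
    filter_upwards [(isOpen_lt continuous_norm continuous_const).mem_nhds hx] with y hy
    exact h y hy
  simp [_root_.pd, this.fderiv_eq]

lemma TF0.pd {N : ℕ} {φ : E N → ℝ} (h : TF0 φ) (i : Fin N) : TF0 (pd i φ) := by
  obtain ⟨h1, δ, hδ, h2⟩ := h
  exact ⟨h1.pd i, δ, hδ, pd_zero_near h2 i⟩

lemma TF.mul {N : ℕ} {φ ψ : E N → ℝ} (h : TF φ) (h' : ContDiff ℝ (⊤ : ℕ∞) ψ) :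
    TF (fun x => φ x * ψ x) := ⟨h.1.mul h', h.2.mul_right⟩

lemma TF.add {N : ℕ} {φ ψ : E N → ℝ} (h : TF φ) (h' : TF ψ) :
    TF (fun x => φ x + ψ x) := ⟨h.1.add h'.1, h.2.add h'.2⟩

lemma TF.sub {N : ℕ} {φ ψ : E N → ℝ} (h : TF φ) (h' : TF ψ) :
    TF (fun x => φ x - ψ x) := ⟨h.1.sub h'.1, h.2.sub h'.2⟩

lemma TF0.sub {N : ℕ} {φ ψ : E N → ℝ} (h : TF0 φ) (h' : TF0 ψ) :
    TF0 (fun x => φ x - ψ x) := by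
  obtain ⟨h1, δ, hδ, h2⟩ := h
  obtain ⟨h3, δ', hδ', h4⟩ := h'
  refine ⟨h1.sub h3, min δ δ', lt_min hδ hδ', fun x hx => ?_⟩
  show φ x - ψ x = 0
  rw [h2 x (hx.trans_le (min_le_left _ _)), h4 x (hx.trans_le (min_le_right _ _)), sub_zero]

lemma TF.const_mul {N : ℕ} {φ : E N → ℝ} (h : TF φ) (c : ℝ) :
    TF (fun x => c * φ x) := ⟨contDiff_const.mul h.1, h.2.mul_left⟩

lemma TF.sum {N : ℕ} {ι : Type*} (s : Finset ι) {φ : ι → E N → ℝ} (h : ∀ i, TF (φ i)) :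
    TF (fun x => ∑ i ∈ s, φ i x) := by
  classical
  induction s using Finset.induction_on with
  | empty => 
    simp only [Finset.sum_empty]
    exact ⟨contDiff_const, HasCompactSupport.zero⟩
  | insert a s ha ih =>
    simp only [Finset.sum_insert ha]
    exact (h a).add ih

lemma TF.lapl {N : ℕ} {φ : E N → ℝ} (h : TF φ) : TF (lapl φ) :=
  TF.sum Finset.univ (fun i => (h.pd i).pd i)

lemma TF.continuous {N : ℕ} {φ : E N → ℝ} (h : TF φ) : Continuous φ := h.1.continuous

lemma TF.differentiable {N : ℕ} {φ : E N → ℝ} (h : TF φ) : Differentiable ℝ φ :=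
  h.1.differentiable (by simp)

lemma TF.integrable {N : ℕ} {φ : E N → ℝ} (h : TF φ) : Integrable φ :=
  h.1.continuous.integrable_of_hasCompactSupport h.2

lemma TF.memLp {N : ℕ} {φ : E N → ℝ} (h : TF φ) (p : ℝ≥0∞) : MemLp φ p volume :=
  h.1.continuous.memLp_of_hasCompactSupport h.2

lemma pd_add {N : ℕ} {φ ψ : E N → ℝ} (h : Differentiable ℝ φ) (h' : Differentiable ℝ ψ)
    (i : Fin N) : pd i (fun x => φ x + ψ x) = fun x => pd i φ x + pd i ψ x := by
  ext x
  simp [pd, fderiv_fun_add (h x) (h' x)]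

lemma pd_sub {N : ℕ} {φ ψ : E N → ℝ} (h : Differentiable ℝ φ) (h' : Differentiable ℝ ψ)
    (i : Fin N) : pd i (fun x => φ x - ψ x) = fun x => pd i φ x - pd i ψ x := by
  ext x
  simp [pd, fderiv_fun_sub (h x) (h' x)]

lemma pd_mul {N : ℕ} {φ ψ : E N → ℝ} (h : Differentiable ℝ φ) (h' : Differentiable ℝ ψ)
    (i : Fin N) : pd i (fun x => φ x * ψ x) = fun x => φ x * pd i ψ x + ψ x * pd i φ x := by
  ext x
  simp [pd, fderiv_fun_mul (h x) (h' x)]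

lemma pd_const_mul {N : ℕ} {φ : E N → ℝ} (h : Differentiable ℝ φ) (c : ℝ)
    (i : Fin N) : pd i (fun x => c * φ x) = fun x => c * pd i φ x := by
  ext x
  simp [pd, fderiv_const_mul (h x)]

lemma lapl_add {N : ℕ} {φ ψ : E N → ℝ} (h : TF φ) (h' : TF ψ) (x : E N) :
    lapl (fun x => φ x + ψ x) x = lapl φ x + lapl ψ x := by
  simp only [lapl_eq, ← Finset.sum_add_distrib]
  refine Finset.sum_congr rfl fun i _ => ?_
  rw [pd_add h.differentiable h'.differentiable,
    pd_add (h.pd i).differentiable (h'.pd i).differentiable]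

lemma lapl_sub {N : ℕ} {φ ψ : E N → ℝ} (h : TF φ) (h' : TF ψ) (x : E N) :
    lapl (fun x => φ x - ψ x) x = lapl φ x - lapl ψ x := by
  simp only [lapl_eq, ← Finset.sum_sub_distrib]
  refine Finset.sum_congr rfl fun i _ => ?_
  rw [pd_sub h.differentiable h'.differentiable,
    pd_sub (h.pd i).differentiable (h'.pd i).differentiable]

lemma lapl_const_mul {N : ℕ} {φ : E N → ℝ} (h : TF φ) (c : ℝ) (x : E N) :
    lapl (fun x => c * φ x) x = c * lapl φ x := by
  simp only [lapl_eq, Finset.mul_sum]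
  refine Finset.sum_congr rfl fun i _ => ?_
  rw [pd_const_mul h.differentiable, pd_const_mul (h.pd i).differentiable]

lemma pd_comm {N : ℕ} {φ : E N → ℝ} (h : ContDiff ℝ (⊤ : ℕ∞) φ) (i j : Fin N) :
    pd i (pd j φ) = pd j (pd i φ) := by
  ext x
  have hs : IsSymmSndFDerivAt ℝ φ x := (h.contDiffAt).isSymmSndFDerivAt (by
    simp only [minSmoothness_of_isRCLikeNormedField]; exact WithTop.coe_le_coe.2 (le_top : (2 : ℕ∞) ≤ ⊤))
  have hd : Differentiable ℝ (fderiv ℝ φ) :=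
    (h.fderiv_right (m := (⊤ : ℕ∞)) (by simp)).differentiable (by simp)
  have key : ∀ i j : Fin N, pd i (pd j φ) x =
      fderiv ℝ (fderiv ℝ φ) x (EuclideanSpace.single i 1) (EuclideanSpace.single j 1) := by
    intro i j
    have : fderiv ℝ (fun y => fderiv ℝ φ y (EuclideanSpace.single j 1)) x =
      (fderiv ℝ (fderiv ℝ φ) x).flip (EuclideanSpace.single j 1) := by
      rw [fderiv_clm_apply (hd x) (differentiableAt_const _)]
      simp
    show fderiv ℝ (fun y => fderiv ℝ φ y (EuclideanSpace.single j 1)) x _ = _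
    rw [this]; rfl
  rw [key, key]
  exact hs _ _

lemma ibp {N : ℕ} {f g : E N → ℝ} (hf : TF f) (hg : ContDiff ℝ (⊤ : ℕ∞) g) (i : Fin N) :
    ∫ x, f x * pd i g x = - ∫ x, pd i f x * g x := by
  refine integral_mul_fderiv_eq_neg_fderiv_mul_of_integrable ?_ ?_ ?_ ?_ ?_
  · exact ((hf.pd i).mul hg).integrable
  · exact (hf.mul (contDiff_pd hg i)).integrable
  · exact (hf.mul hg).integrable
  · exact fun x _ => hf.differentiable x
  · exact fun x _ => hg.differentiable (by simp) x

lemma ibp2 {N : ℕ} {f g : E N → ℝ} (hf : TF f) (hg : TF g) (i : Fin N) :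
    ∫ x, f x * pd i (pd i g) x = ∫ x, pd i (pd i f) x * g x := by
  rw [ibp hf (hg.pd i).1, ibp (hf.pd i) hg.1, neg_neg]

lemma integral_lapl_mul {N : ℕ} {f g : E N → ℝ} (hf : TF f) (hg : TF g) :
    ∫ x, lapl f x * g x = ∫ x, f x * lapl g x := by
  simp only [lapl_eq, Finset.sum_mul, Finset.mul_sum]
  rw [integral_finsetSum, integral_finsetSum]
  · exact Finset.sum_congr rfl fun i _ => (ibp2 hf hg i).symm
  · exact fun i _ => (hf.mul ((hg.pd i).pd i).1).integrable
  · exact fun i _ => (((hf.pd i).pd i).mul hg.1).integrable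

lemma hessian_identity {N : ℕ} {φ : E N → ℝ} (h : TF φ) :
    ∑ i, ∑ j, ∫ x, (pd i (pd j φ) x) ^ 2 = ∫ x, (lapl φ x) ^ 2 := by
  have h1 : ∀ i j : Fin N, ∫ x, (pd i (pd j φ) x) ^ 2
      = ∫ x, pd i (pd i φ) x * pd j (pd j φ) x := by
    intro i j
    simp only [sq]
    rw [ibp ((h.pd j).pd i) (h.pd j).1 i, pd_comm h.1 i j, pd_comm (h.pd i).1 i j,
      ibp ((h.pd i).pd i) (h.pd j).1 j]
  simp only [h1]
  simp only [lapl_eq, sq, Finset.sum_mul_sum]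
  rw [integral_finsetSum]
  · refine Finset.sum_congr rfl fun i _ => ?_
    rw [integral_finsetSum]
    exact fun j _ => (((h.pd i).pd i).mul ((h.pd j).pd j).1).integrable
  · intro i _
    exact (TF.sum Finset.univ fun j => ((h.pd i).pd i).mul ((h.pd j).pd j).1).integrable

lemma contDiff_coord {N : ℕ} (j : Fin N) : ContDiff ℝ (⊤ : ℕ∞) (fun y : E N => y j) := by
  fun_prop

lemma pd_coord {N : ℕ} (j : Fin N) (x : E N) : pd j (fun y : E N => y j) x = 1 := by
  have : HasFDerivAt (fun y : E N => y j) (EuclideanSpace.proj j : E N →L[ℝ] ℝ) x :=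
    (EuclideanSpace.proj j : E N →L[ℝ] ℝ).hasFDerivAt
  simp [pd, this.fderiv]

lemma pd_normsq {N : ℕ} (j : Fin N) (x : E N) : pd j (fun y : E N => ‖y‖ ^ 2) x = 2 * x j := by
  have := (hasStrictFDerivAt_norm_sq x).hasFDerivAt
  simp [pd, this.fderiv, EuclideanSpace.inner_single_right]

lemma TF0.div_normsq {N : ℕ} {v : E N → ℝ} (h : TF0 v) :
    TF0 (fun y => v y * (‖y‖ ^ 2)⁻¹) := by
  obtain ⟨h1, δ, hδ, h2⟩ := h
  refine ⟨⟨?_, h1.2.mul_right⟩, δ, hδ, fun x hx => by simp [h2 x hx]⟩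
  rw [contDiff_iff_contDiffAt]
  intro x
  by_cases hx : ‖x‖ < δ
  · have : (fun y => v y * (‖y‖ ^ 2)⁻¹) =ᶠ[𝓝 x] fun _ => 0 := by
      filter_upwards [(isOpen_lt continuous_norm continuous_const).mem_nhds hx] with y hy
      simp [h2 y hy]
    exact contDiffAt_const.congr_of_eventuallyEq this
  · have hx0 : x ≠ 0 := by rintro rfl; simp [hδ] at hx
    exact h1.1.contDiffAt.mul ((contDiff_norm_sq ℝ).contDiffAt.inv (by positivity))

lemma sum_sq_norm {N : ℕ} (y : E N) : ∑ j, y j ^ 2 = ‖y‖ ^ 2 := by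
  rw [EuclideanSpace.norm_sq_eq]; simp

lemma hardy {N : ℕ} (hN : 4 ≤ N) {v : E N → ℝ} (h : TF0 v) :
    ∫ y, v y ^ 2 * (‖y‖ ^ 2)⁻¹ ≤ ∫ y, ∑ j, (pd j v y) ^ 2 := by
  set p : E N → ℝ := fun y => v y * (‖y‖ ^ 2)⁻¹ with hp
  have hpT : TF0 p := h.div_normsq
  set F : E N → ℝ := fun y => p y * v y with hF
  have hFT : TF F := hpT.1.mul h.1.1
  have hpv : ∀ y, p y * ‖y‖ ^ 2 = v y := by
    intro y
    by_cases hy : y = 0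
    · obtain ⟨h1, δ, hδ, h2⟩ := h
      simp [hy, h2 0 (by simpa using hδ)]
    · have : ‖y‖ ≠ 0 := by simpa using hy
      simp only [hp]; field_simp
  have hvv : (fun y => F y * ‖y‖ ^ 2) = fun y => v y * v y := by
    ext y
    rw [← hpv y]; simp only [hF]; rw [← hpv y]; ring
  have hcn : ContDiff ℝ (⊤ : ℕ∞) (fun y : E N => ‖y‖ ^ 2) := contDiff_norm_sq ℝ
  -- pointwise
  have hpt : ∀ y, ∑ j, y j * pd j F y = 2 * (p y * ∑ j, y j * pd j v y) - 2 * F y := by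
    intro y
    by_cases hy : y = 0
    · obtain ⟨h1, δ, hδ, h2⟩ := h
      have : v 0 = 0 := h2 0 (by simpa using hδ)
      simp [hy, hF, hp, this]
    · have hne : ‖y‖ ^ 2 ≠ 0 := by positivity
      have e : ∀ j, F y * (2 * y j) + ‖y‖ ^ 2 * pd j F y = 2 * (v y * pd j v y) := by
        intro j
        have h1 := pd_mul hFT.differentiable (hcn.differentiable (by simp)) j
        have h2 := pd_mul h.1.differentiable h.1.differentiable j
        rw [hvv, h2] at h1
        have := congrFun h1 y
        simp only [pd_normsq] at this
        linarith
      have e2 : ‖y‖ ^ 2 * ∑ j, y j * pd j F y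
          = ‖y‖ ^ 2 * (2 * (p y * ∑ j, y j * pd j v y) - 2 * F y) := by
        have : ‖y‖ ^ 2 * ∑ j, y j * pd j F y
          = 2 * v y * ∑ j, y j * pd j v y - 2 * F y * ∑ j, y j ^ 2 := by
          simp only [Finset.mul_sum, ← Finset.sum_sub_distrib]
          refine Finset.sum_congr rfl fun j _ => ?_
          linear_combination y j * e j
        rw [this, sum_sq_norm, ← hpv y]; ring
      exact mul_left_cancel₀ hne e2
  have hInt : ∫ y, ∑ j, y j * pd j F y = - (N : ℝ) * ∫ y, F y := by
    rw [integral_finsetSum]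
    · have : ∀ j : Fin N, ∫ y : E N, y j * pd j F y = - ∫ y, F y := by
        intro j
        have := ibp hFT (contDiff_coord j) j
        simp only [pd_coord, mul_one] at this
        rw [this, neg_neg]
        exact integral_congr_ae (Eventually.of_forall fun y => mul_comm _ _)
      simp [this]
    · intro j _
      have := ((hFT.pd j).mul (contDiff_coord j)).integrable
      exact this.congr (Eventually.of_forall fun y => mul_comm _ _)
  have hG : TF (fun y => p y * ∑ j, y j * pd j v y) := by
    refine hpT.1.mul ?_
    refine ContDiff.sum fun j _ => (contDiff_coord j).mul (contDiff_pd h.1.1 j)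
  have hS : TF (fun y => ∑ j, (pd j v y) ^ 2) := by
    refine TF.sum _ fun j => ?_
    simp only [sq]; exact (h.1.pd j).mul (h.1.pd j).1
  have hid : ((N : ℝ) - 2) * ∫ y, F y = ∫ y, -2 * (p y * ∑ j, y j * pd j v y) := by
    simp only [hpt] at hInt
    rw [integral_sub (hG.integrable.const_mul 2) (hFT.integrable.const_mul 2),
      integral_const_mul, integral_const_mul] at hInt
    rw [integral_const_mul]
    linarith
  have hle : ∫ y, -2 * (p y * ∑ j, y j * pd j v y) ≤ ∫ y, (F y + ∑ j, (pd j v y) ^ 2) := by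
    refine integral_mono (hG.integrable.const_mul _) (hFT.integrable.add hS.integrable) fun y => ?_
    have : F y = ∑ j, (p y * y j) ^ 2 := by
      simp only [mul_pow, ← Finset.mul_sum, sum_sq_norm]
      simp only [hF]; rw [← hpv y]; ring
    simp only [this, Finset.mul_sum, ← Finset.sum_add_distrib]
    refine Finset.sum_le_sum fun j _ => ?_
    nlinarith [sq_nonneg (p y * y j + pd j v y)]
  rw [integral_add hFT.integrable hS.integrable, ← hid] at hle
  have hFnn : 0 ≤ ∫ y, F y := by
    refine integral_nonneg fun y => ?_
    simp only [hF, hp]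
    have : v y * (‖y‖ ^ 2)⁻¹ * v y = v y ^ 2 * (‖y‖ ^ 2)⁻¹ := by ring
    simp only [this, Pi.zero_apply]; positivity
  have hN' : (4 : ℝ) ≤ N := by exact_mod_cast hN
  have : ∫ y, v y ^ 2 * (‖y‖ ^ 2)⁻¹ = ∫ y, F y :=
    integral_congr_ae (Eventually.of_forall fun y => by simp only [hF, hp]; ring)
  rw [this]
  nlinarith

/-- The radial part of the Laplacian. -/
def rayLap {N : ℕ} (φ : E N → ℝ) (y : E N) : ℝ :=
  (∑ i, ∑ j, pd i (pd j φ) y * y i * y j) * (‖y‖ ^ 2)⁻¹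
    + ((N : ℝ) - 1) * ((∑ i, pd i φ y * y i) * (‖y‖ ^ 2)⁻¹)

lemma rayLap_TF0 {N : ℕ} {φ : E N → ℝ} (h : TF0 φ) : TF0 (rayLap φ) := by
  have hsum : ∀ {ι : Type} (s : Finset ι) {g : ι → E N → ℝ} (δ : ℝ)
      (_ : ∀ i, ∀ x, ‖x‖ < δ → g i x = 0), ∀ x, ‖x‖ < δ → ∑ i ∈ s, g i x = 0 := by
    intro ι s g δ hg x hx
    exact Finset.sum_eq_zero fun i _ => hg i x hx
  obtain ⟨h1, δ, hδ, h2⟩ := h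
  have hA : TF0 (fun y => ∑ i, ∑ j, pd i (pd j φ) y * y i * y j) := by
    refine ⟨TF.sum _ fun i => TF.sum _ fun j =>
      (((h1.pd j).pd i).mul (contDiff_coord i)).mul (contDiff_coord j), δ, hδ, ?_⟩
    intro x hx
    exact Finset.sum_eq_zero fun i _ => Finset.sum_eq_zero fun j _ => by
      rw [pd_zero_near (pd_zero_near h2 j) i x hx]; simp
  have hB : TF0 (fun y => ∑ i, pd i φ y * y i) := by
    refine ⟨TF.sum _ fun i => (h1.pd i).mul (contDiff_coord i), δ, hδ, ?_⟩
    intro x hx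
    exact Finset.sum_eq_zero fun i _ => by
      rw [pd_zero_near h2 i x hx]; simp
  refine ⟨hA.div_normsq.1.add (hB.div_normsq.1.const_mul _), δ, hδ, fun x hx => ?_⟩
  simp [rayLap, pd_zero_near h2 _ x hx, pd_zero_near (pd_zero_near h2 _) _ x hx]

lemma rayLap_sub {N : ℕ} {φ ψ : E N → ℝ} (h : TF φ) (h' : TF ψ) (x : E N) :
    rayLap (fun x => φ x - ψ x) x = rayLap φ x - rayLap ψ x := by
  have e : ∀ i j, pd i (pd j (fun x => φ x - ψ x)) x = pd i (pd j φ) x - pd i (pd j ψ) x := by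
    intro i j
    rw [pd_sub h.differentiable h'.differentiable,
      pd_sub (h.pd j).differentiable (h'.pd j).differentiable]
  have e' : ∀ i, pd i (fun x => φ x - ψ x) x = pd i φ x - pd i ψ x := by
    intro i
    rw [pd_sub h.differentiable h'.differentiable]
  simp only [rayLap, e, e', sub_mul, Finset.sum_sub_distrib]
  ring

lemma rayLap_sq_le {N : ℕ} (φ : E N → ℝ) (y : E N) :
    rayLap φ y ^ 2 ≤ 2 * (∑ i, ∑ j, pd i (pd j φ) y ^ 2)
      + 2 * ((N : ℝ) - 1) ^ 2 * ∑ i, pd i φ y ^ 2 * (‖y‖ ^ 2)⁻¹ := by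
  set t := (‖y‖ ^ 2)⁻¹ with ht
  have ht0 : 0 ≤ t := by positivity
  have hty : ‖y‖ ^ 2 * t ≤ 1 := by
    rw [ht]; exact mul_inv_le_one
  have hcs2 : (∑ i, pd i φ y * y i) ^ 2 ≤ (∑ i, pd i φ y ^ 2) * ‖y‖ ^ 2 := by
    rw [← sum_sq_norm]; exact Finset.sum_mul_sq_le_sq_mul_sq _ _ _
  have hcs1 : (∑ i, ∑ j, pd i (pd j φ) y * y i * y j) ^ 2
      ≤ (∑ i, ∑ j, pd i (pd j φ) y ^ 2) * (‖y‖ ^ 2 * ‖y‖ ^ 2) := by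
    have := Finset.sum_mul_sq_le_sq_mul_sq (Finset.univ ×ˢ Finset.univ)
      (fun q : Fin N × Fin N => pd q.1 (pd q.2 φ) y) (fun q => y q.1 * y q.2)
    simp only [Finset.sum_product, mul_pow, ← mul_assoc] at this
    refine this.trans (le_of_eq ?_)
    congr 1
    rw [← sum_sq_norm, Finset.sum_mul_sum]
  have hA : ((∑ i, ∑ j, pd i (pd j φ) y * y i * y j) * t) ^ 2
      ≤ ∑ i, ∑ j, pd i (pd j φ) y ^ 2 := by
    have h0 : 0 ≤ ∑ i, ∑ j, pd i (pd j φ) y ^ 2 := by positivity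
    have h1 : 0 ≤ ‖y‖ ^ 2 * t := by positivity
    calc _ = (∑ i, ∑ j, pd i (pd j φ) y * y i * y j) ^ 2 * t ^ 2 := by ring
      _ ≤ (∑ i, ∑ j, pd i (pd j φ) y ^ 2) * (‖y‖ ^ 2 * ‖y‖ ^ 2) * t ^ 2 := by gcongr
      _ = (∑ i, ∑ j, pd i (pd j φ) y ^ 2) * (‖y‖ ^ 2 * t) ^ 2 := by ring
      _ ≤ (∑ i, ∑ j, pd i (pd j φ) y ^ 2) * 1 := by gcongr; exact pow_le_one₀ h1 hty
      _ = _ := mul_one _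
  have hB : ((∑ i, pd i φ y * y i) * t) ^ 2 ≤ ∑ i, pd i φ y ^ 2 * t := by
    rw [← Finset.sum_mul]
    have h0 : 0 ≤ ∑ i, pd i φ y ^ 2 := by positivity
    calc _ = (∑ i, pd i φ y * y i) ^ 2 * t ^ 2 := by ring
      _ ≤ (∑ i, pd i φ y ^ 2) * ‖y‖ ^ 2 * t ^ 2 := by gcongr
      _ = (∑ i, pd i φ y ^ 2) * t * (‖y‖ ^ 2 * t) := by ring
      _ ≤ (∑ i, pd i φ y ^ 2) * t * 1 := by gcongr
      _ = _ := mul_one _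
  have hab : ∀ a b c : ℝ, (a + c * b) ^ 2 ≤ 2 * a ^ 2 + 2 * c ^ 2 * b ^ 2 := by
    intro a b c; nlinarith [sq_nonneg (a - c * b)]
  refine (hab _ _ _).trans ?_
  gcongr

lemma rayLap_bound {N : ℕ} (hN : 4 ≤ N) {φ : E N → ℝ} (h : TF0 φ) :
    ∫ y, rayLap φ y ^ 2 ≤ (2 + 2 * ((N : ℝ) - 1) ^ 2) * ∫ y, lapl φ y ^ 2 := by
  have hi1 : ∀ i j, Integrable (fun y => pd i (pd j φ) y ^ 2) := fun i j => by
    simp only [sq]; exact (((h.1.pd j).pd i).mul ((h.1.pd j).pd i).1).integrable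
  have hi2 : ∀ i, Integrable (fun y => pd i φ y ^ 2 * (‖y‖ ^ 2)⁻¹) := fun i => by
    have := ((h.pd i).div_normsq.1.mul (h.pd i).1.1).integrable
    refine this.congr (Eventually.of_forall fun y => ?_)
    show _ = _
    ring
  have hi0 : Integrable (fun y => rayLap φ y ^ 2) := by
    simp only [sq]; exact ((rayLap_TF0 h).1.mul (rayLap_TF0 h).1.1).integrable
  have s1 := integral_mono hi0 (((integrable_finsetSum _ fun i _ =>
      integrable_finsetSum _ fun j _ => hi1 i j).const_mul 2).add
      ((integrable_finsetSum _ fun i _ => hi2 i).const_mul (2 * ((N : ℝ) - 1) ^ 2)))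
      (rayLap_sq_le φ)
  refine s1.trans ?_
  simp only [Pi.add_apply]
  rw [integral_add, integral_const_mul, integral_const_mul, integral_finsetSum,
    integral_finsetSum]
  · have e1 : ∑ i, ∫ y, ∑ j, pd i (pd j φ) y ^ 2 = ∫ y, lapl φ y ^ 2 := by
      rw [← hessian_identity h.1]
      refine Finset.sum_congr rfl fun i _ => ?_
      rw [integral_finsetSum _ fun j _ => hi1 i j]
    have e2 : ∑ i, ∫ y, pd i φ y ^ 2 * (‖y‖ ^ 2)⁻¹ ≤ ∫ y, lapl φ y ^ 2 := by
      rw [← hessian_identity h.1, Finset.sum_comm]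
      refine Finset.sum_le_sum fun i _ => ?_
      rw [← integral_finsetSum _ fun j _ => hi1 j i]
      exact hardy hN (h.pd i)
    rw [e1, add_mul]
    gcongr
  · exact fun i _ => hi2 i
  · exact fun i _ => integrable_finsetSum _ fun j _ => hi1 i j
  · exact (integrable_finsetSum _ fun i _ =>
      integrable_finsetSum _ fun j _ => hi1 i j).const_mul 2
  · exact (integrable_finsetSum _ fun i _ => hi2 i).const_mul (2 * ((N : ℝ) - 1) ^ 2)

end

noncomputable section

lemma pd_norm {N : ℕ} (i : Fin N) {x : E N} (hx : x ≠ 0) :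
    pd i (fun y : E N => ‖y‖) x = x i * ‖x‖⁻¹ := by
  have hd : DifferentiableAt ℝ (fun y : E N => ‖y‖) x := (contDiffAt_norm ℝ (n := 1) hx).differentiableAt (by simp)
  have h := pd_normsq i x
  have : ‖x‖ ≠ 0 := by simpa using hx
  simp only [pd, sq] at h
  rw [fderiv_fun_mul hd hd] at h
  simp at h
  simp only [pd]
  field_simp
  linarith

lemma fderiv_eq_sum {N : ℕ} (φ : E N → ℝ) (y ω : E N) :
    fderiv ℝ φ y ω = ∑ k, ω k * pd k φ y := by
  have : ω = ∑ k, ω k • EuclideanSpace.single k (1 : ℝ) := by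
    ext j; simp [Finset.sum_apply, Pi.single_apply]
  conv_lhs => rw [this]
  simp [map_sum, pd]

/-- Derivative in the direction `ω`. -/
def dirD {N : ℕ} (ω : E N) (φ : E N → ℝ) (y : E N) : ℝ := ∑ k, ω k * pd k φ y

lemma dirD_zero_near {N : ℕ} {φ : E N → ℝ} {δ : ℝ} (h : ∀ x, ‖x‖ < δ → φ x = 0) (ω : E N) :
    ∀ x, ‖x‖ < δ → dirD ω φ x = 0 := fun x hx => by
  simp [dirD, pd_zero_near h _ x hx]

lemma TF0.dirD {N : ℕ} {φ : E N → ℝ} (h : TF0 φ) (ω : E N) : TF0 (dirD ω φ) := by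
  obtain ⟨h1, δ, hδ, h2⟩ := h
  exact ⟨TF.sum _ fun k => (h1.pd k).const_mul _, δ, hδ, dirD_zero_near h2 ω⟩

lemma ray_TF0 {N : ℕ} {φ : E N → ℝ} (h : TF0 φ) {ω : E N} (hω : ‖ω‖ = 1) :
    TF0 (fun x : E N => φ (‖x‖ • ω)) := by
  obtain ⟨h1, δ, hδ, h2⟩ := h
  have hn : ∀ x : E N, ‖‖x‖ • ω‖ = ‖x‖ := fun x => by simp [norm_smul, hω]
  have hz : ∀ x : E N, ‖x‖ < δ → φ (‖x‖ • ω) = 0 := fun x hx => h2 _ (by rwa [hn])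
  refine ⟨⟨?_, ?_⟩, δ, hδ, hz⟩
  · rw [contDiff_iff_contDiffAt]
    intro x
    by_cases hx : ‖x‖ < δ
    · have : (fun x : E N => φ (‖x‖ • ω)) =ᶠ[𝓝 x] fun _ => 0 := by
        filter_upwards [(isOpen_lt continuous_norm continuous_const).mem_nhds hx] with y hy
        exact hz y hy
      exact contDiffAt_const.congr_of_eventuallyEq this
    · have hx0 : x ≠ 0 := by rintro rfl; simp [hδ] at hx
      have := (contDiffAt_norm ℝ (n := (⊤ : ℕ∞)) hx0).smul (contDiffAt_const (c := ω))
      exact h1.1.contDiffAt.comp x this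
  · obtain ⟨R, hR⟩ := h1.2.isCompact.isBounded.subset_closedBall (0 : E N)
    refine HasCompactSupport.of_support_subset_isCompact (isCompact_closedBall (0 : E N) R) ?_
    intro x hx
    have := hR (subset_tsupport _ (show ‖x‖ • ω ∈ Function.support φ from hx))
    simpa [hn] using this

lemma pd_ray {N : ℕ} {φ : E N → ℝ} (h : TF0 φ) {ω : E N} (hω : ‖ω‖ = 1) (i : Fin N) :
    pd i (fun x : E N => φ (‖x‖ • ω)) = fun x : E N => dirD ω φ (‖x‖ • ω) * (x i * ‖x‖⁻¹) := by
  ext x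
  by_cases hx : x = 0
  · obtain ⟨h1, δ, hδ, h2⟩ := h
    have hz : ∀ x : E N, ‖x‖ < δ → φ (‖x‖ • ω) = 0 := fun x hx =>
      h2 _ (by simpa [norm_smul, hω] using hx)
    rw [pd_zero_near hz i x (by simpa [hx] using hδ)]
    simp [hx]
  · have hd : DifferentiableAt ℝ (fun y : E N => ‖y‖) x :=
      (contDiffAt_norm ℝ (n := 1) hx).differentiableAt (by simp)
    have h1 : HasFDerivAt (fun y : E N => ‖y‖ • ω) _ x := hd.hasFDerivAt.smul_const ω
    have h2 := (h.1.differentiable (‖x‖ • ω)).hasFDerivAt.comp x h1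
    have h3 : fderiv ℝ (fun x => φ (‖x‖ • ω)) x = _ := h2.fderiv
    rw [← pd_norm i hx, pd, h3]
    have h4 : dirD ω φ (‖x‖ • ω) = fderiv ℝ φ (‖x‖ • ω) ω := (fderiv_eq_sum φ _ ω).symm
    rw [h4]
    simp [pd, mul_comm]

lemma pd_unit {N : ℕ} (i : Fin N) {x : E N} (hx : x ≠ 0) :
    pd i (fun y : E N => y i * ‖y‖⁻¹) x = ‖x‖⁻¹ - (x i) ^ 2 * (‖x‖⁻¹) ^ 3 := by
  have hd : DifferentiableAt ℝ (fun y : E N => ‖y‖) x :=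
    (contDiffAt_norm ℝ (n := 1) hx).differentiableAt (by simp)
  have hx' : ‖x‖ ≠ 0 := by simpa using hx
  have hd2 : DifferentiableAt ℝ (fun y : E N => ‖y‖⁻¹) x := hd.inv hx'
  have hc : DifferentiableAt ℝ (fun y : E N => y i) x :=
    (contDiff_coord i).differentiable (by simp) x
  have e1 := pd_coord i x
  have e2 := pd_norm i hx
  have e3 : fderiv ℝ (fun y : E N => ‖y‖⁻¹) x = _ := ((hasDerivAt_inv hx').comp_hasFDerivAt x hd.hasFDerivAt).fderiv
  simp only [pd] at e1 e2 ⊢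
  rw [fderiv_fun_mul hc hd2, e3]
  simp [e1, e2]
  field_simp
  ring

lemma lapl_ray {N : ℕ} {φ : E N → ℝ} (h : TF0 φ) {ω : E N} (hω : ‖ω‖ = 1) (x : E N) :
    lapl (fun x : E N => φ (‖x‖ • ω)) x = rayLap φ (‖x‖ • ω) := by
  by_cases hx : x = 0
  · obtain ⟨h1, δ, hδ, h2⟩ := h
    have hz : ∀ x : E N, ‖x‖ < δ → φ (‖x‖ • ω) = 0 := fun x hx =>
      h2 _ (by simpa [norm_smul, hω] using hx)
    have hxδ : ‖x‖ < δ := by simpa [hx] using hδ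
    rw [lapl_eq, Finset.sum_eq_zero fun i _ => pd_zero_near (pd_zero_near hz i) i x hxδ]
    simp [hx, rayLap]
  have hx' : ‖x‖ ≠ 0 := by simpa using hx
  have hd : DifferentiableAt ℝ (fun y : E N => ‖y‖) x :=
    (contDiffAt_norm ℝ (n := 1) hx).differentiableAt (by simp)
  have key : ∀ i, pd i (pd i (fun x : E N => φ (‖x‖ • ω))) x
      = dirD ω (dirD ω φ) (‖x‖ • ω) * ((x i) ^ 2 * (‖x‖⁻¹) ^ 2)
        + dirD ω φ (‖x‖ • ω) * (‖x‖⁻¹ - (x i) ^ 2 * (‖x‖⁻¹) ^ 3) := by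
    intro i
    rw [pd_ray h hω i]
    have hc : DifferentiableAt ℝ (fun y : E N => y i * ‖y‖⁻¹) x :=
      ((contDiff_coord i).differentiable (by simp) x).mul (hd.inv hx')
    have hD : DifferentiableAt ℝ (fun x : E N => dirD ω φ (‖x‖ • ω)) x :=
      (ray_TF0 (h.dirD ω) hω).1.differentiable x
    have e1 := congrFun (pd_ray (h.dirD ω) hω i) x
    have e2 := pd_unit i hx
    simp only [pd] at e1 e2 ⊢
    rw [fderiv_fun_mul hD hc]
    simp only [add_apply, smul_apply, e1, e2, smul_eq_mul]
    ring
  rw [lapl_eq]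
  simp only [key, Finset.sum_add_distrib, ← Finset.mul_sum, Finset.sum_sub_distrib,
    ← Finset.sum_mul, sum_sq_norm]
  have eA : dirD ω (dirD ω φ) (‖x‖ • ω) = ∑ i, ∑ j, ω i * (ω j * pd i (pd j φ) (‖x‖ • ω)) := by
    unfold dirD
    refine Finset.sum_congr rfl fun i _ => ?_
    rw [← Finset.mul_sum]
    congr 1
    simp only [pd]
    rw [fderiv_fun_sum]
    · simp only [sum_apply]
      refine Finset.sum_congr rfl fun j _ => ?_
      exact congrFun (pd_const_mul (h.1.pd j).differentiable (ω j) i) _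
    · exact fun j _ => ((h.1.pd j).differentiable.const_mul (ω j)) _
  have hn : ‖‖x‖ • ω‖ = ‖x‖ := by simp [norm_smul, hω]
  have eB : ∑ i, ∑ j, pd i (pd j φ) (‖x‖ • ω) * (‖x‖ • ω) i * (‖x‖ • ω) j
      = ‖x‖ ^ 2 * dirD ω (dirD ω φ) (‖x‖ • ω) := by
    rw [eA]
    simp only [Finset.mul_sum]
    refine Finset.sum_congr rfl fun i _ => Finset.sum_congr rfl fun j _ => ?_
    simp; ring
  have eC : ∑ i, pd i φ (‖x‖ • ω) * (‖x‖ • ω) i = ‖x‖ * dirD ω φ (‖x‖ • ω) := by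
    simp only [dirD, Finset.mul_sum]
    refine Finset.sum_congr rfl fun i _ => ?_
    simp; ring
  unfold rayLap
  rw [eB, eC, hn]
  simp
  field_simp
  try ring

lemma lapl_radial {N : ℕ} {ψ : E N → ℝ} (h : TF0 ψ) (hr : IsRadial ψ) :
    IsRadial (lapl ψ) := by
  intro x y hxy
  by_cases hx : x = 0
  · have : y = 0 := by rw [hx] at hxy; simpa using hxy.symm
    rw [hx, this]
  have hx' : ‖x‖ ≠ 0 := by simpa using hx
  set ω : E N := ‖x‖⁻¹ • x
  have hω : ‖ω‖ = 1 := by simp [ω, norm_smul, hx']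
  have e : (fun z : E N => ψ (‖z‖ • ω)) = ψ := by
    ext z; exact hr _ _ (by simp [norm_smul, hω])
  have := lapl_ray h hω
  rw [e] at this
  rw [this, this, hxy]

end

noncomputable section

/-- The unit sphere. -/
abbrev Sph (N : ℕ) := Metric.sphere (0 : E N) 1

/-- Normalized surface measure. -/
def Psph (N : ℕ) : Measure (Sph N) :=
  ((volume : Measure (E N)).toSphere univ)⁻¹ • (volume : Measure (E N)).toSphere

lemma sphere_univ_ne_zero {N : ℕ} (hN : 5 ≤ N) :
    (volume : Measure (E N)).toSphere univ ≠ 0 := by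
  have : Nonempty (Fin N) := ⟨⟨0, by omega⟩⟩
  have : Nontrivial (E N) := inferInstance
  simp only [ne_eq, Measure.measure_univ_eq_zero]
  exact Measure.toSphere_ne_zero _

lemma prob_Psph {N : ℕ} (hN : 5 ≤ N) : IsProbabilityMeasure (Psph N) := by
  constructor
  simp only [Psph, Measure.smul_apply, smul_eq_mul]
  exact ENNReal.inv_mul_cancel (sphere_univ_ne_zero hN) (measure_ne_top _ _)

/-- The ray map. -/
def rayMap (N : ℕ) (q : Sph N × E N) : E N := ‖q.2‖ • (q.1 : E N)

lemma continuous_rayMap (N : ℕ) : Continuous (rayMap N) := by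
  unfold rayMap; fun_prop

lemma lintegral_polar {N : ℕ} (hN : 5 ≤ N) {g : E N → ℝ≥0∞} :
    ∫⁻ x, g x = ∫⁻ q, g ((q.2 : ℝ) • (q.1 : E N))
      ∂((volume : Measure (E N)).toSphere.prod (Measure.volumeIoiPow (Module.finrank ℝ (E N) - 1))) := by
  have h1 : ∫⁻ x, g x = ∫⁻ x : ({0}ᶜ : Set (E N)), g x ∂(Measure.comap Subtype.val volume) := by
    rw [lintegral_subtype_comap (measurableSet_singleton _).compl]
    have : Nonempty (Fin N) := ⟨⟨0, by omega⟩⟩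
    have : Nontrivial (E N) := inferInstance
    rw [restrict_compl_singleton]
  rw [h1]
  rw [← (Measure.measurePreserving_homeomorphUnitSphereProd (volume : Measure (E N))).lintegral_comp_emb
    (Homeomorph.measurableEmbedding _)]
  refine lintegral_congr fun x => ?_
  have : ‖(x : E N)‖ ≠ 0 := norm_ne_zero_iff.2 (fun h => x.2 h)
  simp [smul_smul, this]

lemma rayMap_mp {N : ℕ} (hN : 5 ≤ N) :
    MeasurePreserving (rayMap N) ((Psph N).prod volume) volume := by
  refine ⟨(continuous_rayMap N).measurable, ?_⟩
  ext s hs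
  rw [Measure.map_apply (continuous_rayMap N).measurable hs]
  have := prob_Psph hN
  set g : E N → ℝ≥0∞ := s.indicator 1 with hg
  have hgm : Measurable g := measurable_one.indicator hs
  have e1 : (Psph N).prod volume (rayMap N ⁻¹' s) = ∫⁻ q, g (rayMap N q) ∂(Psph N).prod volume := by
    rw [← lintegral_indicator_one ((continuous_rayMap N).measurable hs)]
    rfl
  have e2 : volume s = ∫⁻ x, g x := by rw [hg, lintegral_indicator_one hs]
  have hgr : Measurable (fun q => g (rayMap N q)) := hgm.comp (continuous_rayMap N).measurable
  rw [e1, e2, lintegral_prod _ hgr.aemeasurable]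
  have e3 : ∀ ω : Sph N, ∫⁻ x, g (rayMap N (ω, x)) =
     (volume : Measure (E N)).toSphere univ * ∫⁻ r : Ioi (0:ℝ), g ((r : ℝ) • (ω : E N)) ∂(Measure.volumeIoiPow (Module.finrank ℝ (E N) - 1)) := by
    intro ω
    rw [lintegral_polar hN (g := fun x => g (rayMap N (ω, x)))]
    have hm : Measurable (fun r : Ioi (0:ℝ) => g ((r : ℝ) • (ω : E N))) :=
      hgm.comp (by fun_prop)
    rw [lintegral_prod]
    · simp only [rayMap, norm_smul, norm_eq_of_mem_sphere, mul_one, Real.norm_eq_abs]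
      have : ∀ r : Ioi (0:ℝ), |(r:ℝ)| = r := fun r => abs_of_pos r.2
      simp only [this, lintegral_const]
      rw [mul_comm]
    · exact (hgm.comp ((continuous_rayMap N).measurable.comp (by fun_prop))).aemeasurable
  simp only [e3]
  have hm2 : Measurable (fun q : Sph N × Ioi (0:ℝ) => g ((q.2 : ℝ) • (q.1 : E N))) :=
      hgm.comp (by fun_prop)
  rw [lintegral_const_mul _ hm2.lintegral_prod_right', Psph, lintegral_smul_measure, lintegral_polar hN (g := g),
    lintegral_prod _ hm2.aemeasurable]
  rw [smul_eq_mul, ← mul_assoc, ENNReal.mul_inv_cancel (sphere_univ_ne_zero hN) (measure_ne_top _ _), one_mul]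

end

noncomputable section

lemma twoSS_eq {N : ℕ} : twoSS N = ((2 * N : ℕ) : ℝ≥0∞) / ((N - 4 : ℕ) : ℝ≥0∞) := by
  unfold twoSS
  push_cast
  rfl

lemma twoSS_ne_zero {N : ℕ} (hN : 5 ≤ N) : twoSS N ≠ 0 := by
  rw [twoSS_eq]
  simp only [ne_eq, ENNReal.div_eq_zero_iff, Nat.cast_eq_zero, natCast_ne_top, or_false]
  omega

lemma twoSS_ne_top {N : ℕ} (hN : 5 ≤ N) : twoSS N ≠ ⊤ := by
  rw [twoSS_eq]
  refine ENNReal.div_ne_top (natCast_ne_top _) ?_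
  simp only [ne_eq, Nat.cast_eq_zero]
  omega

lemma one_le_twoSS {N : ℕ} (hN : 5 ≤ N) : 1 ≤ twoSS N := by
  rw [twoSS_eq, ENNReal.le_div_iff_mul_le (Or.inr (by simp; omega)) (Or.inr (natCast_ne_top _)), one_mul]
  exact_mod_cast (by omega)

lemma TF.bdd {N : ℕ} {φ : E N → ℝ} (h : TF φ) : ∃ C, 0 ≤ C ∧ ∀ x, |φ x| ≤ C := by
  obtain ⟨C, hC⟩ := h.continuous.bounded_above_of_compact_support h.2
  exact ⟨C, (norm_nonneg _).trans (hC 0), hC⟩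

lemma pd_scale {N : ℕ} (φ : E N → ℝ) (h : Differentiable ℝ φ) (a : ℝ) (i : Fin N) :
    pd i (fun x => φ (a • x)) = fun x => a * pd i φ (a • x) := by
  ext x
  have h1 : HasFDerivAt (fun x : E N => a • x) (a • ContinuousLinearMap.id ℝ (E N)) x :=
    (hasFDerivAt_id x).const_smul a
  have h2 := (h (a • x)).hasFDerivAt.comp x h1
  simp only [pd]
  have h3 : (fun x => φ (a • x)) = φ ∘ (fun x => a • x) := rfl
  rw [h3, h2.fderiv]
  simp

lemma eLpNorm_le_ball {N : ℕ} {g : E N → ℝ} {C ρ : ℝ} (p : ℝ≥0∞) (hC : ∀ x, |g x| ≤ C)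
    (h0 : ∀ x, ρ < ‖x‖ → g x = 0) :
    eLpNorm g p volume ≤ volume (Metric.closedBall (0 : E N) ρ) ^ (p.toReal⁻¹) * ENNReal.ofReal C := by
  have hs : Function.support g ⊆ Metric.closedBall (0 : E N) ρ := by
    intro x hx
    rw [mem_closedBall_zero_iff]
    by_contra hc
    exact hx (h0 x (not_le.1 hc))
  rw [← eLpNorm_restrict_eq_of_support_subset hs]
  have := eLpNorm_le_of_ae_bound (p := p) (μ := volume.restrict (Metric.closedBall (0 : E N) ρ))
    (f := g) (C := C) (Eventually.of_forall hC)
  simpa using this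

lemma cutoff_exists {N : ℕ} (hN : 5 ≤ N) {φ : E N → ℝ} (h : TF φ) {p : ℝ≥0∞} (hp0 : p ≠ 0)
    (hp : p ≠ ⊤) : ∃ e : ℕ → E N → ℝ, (∀ n, TF (e n)) ∧ (∀ n, TF0 (fun x => φ x - e n x)) ∧
    Tendsto (fun n => eLpNorm (e n) p volume) atTop (𝓝 0) ∧
    Tendsto (fun n => eLpNorm (lapl (e n)) 2 volume) atTop (𝓝 0) := by
  have : Nonempty (Fin N) := ⟨⟨0, by omega⟩⟩
  have : Nontrivial (E N) := inferInstance
  let b : ContDiffBump (0 : E N) := ⟨1, 2, by norm_num, by norm_num⟩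
  set χ : E N → ℝ := fun x => b x with hχ
  have hχT : TF χ := ⟨b.contDiff, b.hasCompactSupport⟩
  set a : ℕ → ℝ := fun n => (n : ℝ) + 1 with ha
  have ha1 : ∀ n, 1 ≤ a n := fun n => by simp [ha]
  have ha0 : ∀ n, 0 < a n := fun n => by linarith [ha1 n]
  set e : ℕ → E N → ℝ := fun n x => χ (a n • x) * φ x with he
  have hsc : ∀ n, ContDiff ℝ (⊤ : ℕ∞) (fun x : E N => χ (a n • x)) := fun n =>
    hχT.1.comp (contDiff_const_smul (a n))
  have heT : ∀ n, TF (e n) := fun n => by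
    have := h.mul (hsc n)
    simpa only [he, mul_comm] using this
  have hsup : ∀ n x, 2 / a n < ‖x‖ → e n x = 0 := by
    intro n x hx
    have : χ (a n • x) = 0 := by
      apply b.zero_of_le_dist
      rw [dist_zero_right, norm_smul, Real.norm_eq_abs, abs_of_pos (ha0 n)]
      rw [div_lt_iff₀ (ha0 n)] at hx
      show 2 ≤ _
      linarith
    simp [he, this]
  have hchi : ∀ x, |χ x| ≤ 1 := fun x => by
    rw [abs_of_nonneg b.nonneg]; exact b.le_one
  obtain ⟨C0, hC0, hφ⟩ := h.bdd
  have hlb : ∃ C, 0 ≤ C ∧ ∀ n x, |lapl (e n) x| ≤ C * a n ^ 2 := by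
    have : ∀ i : Fin N, ∃ C, 0 ≤ C ∧ ∀ n x, |pd i (pd i (e n)) x| ≤ C * a n ^ 2 := by
      intro i
      obtain ⟨C1, hC1, h1⟩ := (h.pd i).bdd
      obtain ⟨C2, hC2, h2⟩ := ((h.pd i).pd i).bdd
      obtain ⟨D1, hD1, g1⟩ := (hχT.pd i).bdd
      obtain ⟨D2, hD2, g2⟩ := ((hχT.pd i).pd i).bdd
      refine ⟨C2 + D1 * C1 + (D1 * C1 + C0 * D2), by positivity, fun n x => ?_⟩
      have d1 : Differentiable ℝ (fun x : E N => χ (a n • x)) := (hsc n).differentiable (by simp)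
      have d2 : Differentiable ℝ (fun x : E N => pd i χ (a n • x)) :=
        ((hχT.pd i).1.comp (contDiff_const_smul (a n))).differentiable (by simp)
      have e1 : pd i (e n) = fun x => χ (a n • x) * pd i φ x + φ x * (a n * pd i χ (a n • x)) := by
        rw [he]
        simp only
        rw [pd_mul d1 h.differentiable, pd_scale χ hχT.differentiable]
      have k1 : Differentiable ℝ (fun x => χ (a n • x) * pd i φ x) :=
        d1.mul (h.pd i).differentiable
      have k2 : Differentiable ℝ (fun x => φ x * (a n * pd i χ (a n • x))) :=
        h.differentiable.mul (d2.const_mul _)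
      rw [e1, pd_add k1 k2, pd_mul d1 (h.pd i).differentiable, pd_mul h.differentiable (d2.const_mul _),
        pd_const_mul d2, pd_scale χ hχT.differentiable, pd_scale _ (hχT.pd i).differentiable]
      simp only
      have q1 := ha1 n
      have q0 := ha0 n
      have hsq : a n ≤ a n ^ 2 := by nlinarith
      have hsq1 : 1 ≤ a n ^ 2 := by nlinarith
      have t1 : |χ (a n • x) * pd i (pd i φ) x| ≤ C2 * a n ^ 2 := by
        rw [abs_mul]
        calc _ ≤ 1 * C2 := by gcongr; exacts [hchi _, h2 x]
          _ ≤ _ := by nlinarith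
      have t2 : |pd i φ x * (a n * pd i χ (a n • x))| ≤ D1 * C1 * a n ^ 2 := by
        rw [abs_mul, abs_mul, abs_of_pos q0]
        calc _ ≤ C1 * (a n * D1) := by gcongr; exacts [h1 x, g1 _]
          _ = D1 * C1 * a n := by ring
          _ ≤ _ := by gcongr
      have t3 : |φ x * (a n * (a n * pd i (pd i χ) (a n • x)))| ≤ C0 * D2 * a n ^ 2 := by
        rw [abs_mul, abs_mul, abs_mul, abs_of_pos q0]
        calc _ ≤ C0 * (a n * (a n * D2)) := by gcongr; exacts [hφ x, g2 _]
          _ = _ := by ring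
      have t4 : |a n * pd i χ (a n • x) * pd i φ x| ≤ D1 * C1 * a n ^ 2 := by
        rw [mul_comm]; exact t2
      rw [abs_le] at t1 t2 t3 t4 ⊢
      constructor <;> linarith [t1.1, t1.2, t2.1, t2.2, t3.1, t3.2, t4.1, t4.2]
    choose C hC hb using this
    refine ⟨∑ i, C i, Finset.sum_nonneg fun i _ => hC i, fun n x => ?_⟩
    rw [lapl_eq, Finset.sum_mul]
    exact (Finset.abs_sum_le_sum_abs _ _).trans (Finset.sum_le_sum fun i _ => hb i n x)
  obtain ⟨C, hC, hl⟩ := hlb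
  have hsupl : ∀ n x, 2 / a n < ‖x‖ → lapl (e n) x = 0 := by
    intro n x hx
    have hz : ∀ {g : E N → ℝ}, (∀ x, 2 / a n < ‖x‖ → g x = 0) → ∀ i x, 2 / a n < ‖x‖ → pd i g x = 0 := by
      intro g hg i x hx
      have : g =ᶠ[𝓝 x] fun _ => 0 := by
        filter_upwards [(isOpen_lt continuous_const continuous_norm).mem_nhds hx] with y hy
        exact hg y hy
      simp [pd, this.fderiv_eq]
    rw [lapl_eq]
    exact Finset.sum_eq_zero fun i _ => hz (hz (hsup n) i) i x hx
  have hvol : ∀ n, volume (Metric.closedBall (0 : E N) (2 / a n)) =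
      ENNReal.ofReal ((2 / a n) ^ N) * volume (Metric.ball (0 : E N) 1) := fun n => by
    rw [Measure.addHaar_closedBall _ _ (by have := ha0 n; positivity)]
    simp
  have hat : Tendsto (fun n => 2 / a n) atTop (𝓝 0) :=
    tendsto_const_nhds.div_atTop (tendsto_natCast_atTop_atTop.atTop_add tendsto_const_nhds)
  refine ⟨e, heT, fun n => ⟨h.sub (heT n), 1 / a n, by have := ha0 n; positivity, fun x hx => ?_⟩, ?_, ?_⟩
  · have : χ (a n • x) = 1 := by
      apply b.one_of_mem_closedBall
      rw [mem_closedBall_zero_iff, norm_smul, Real.norm_eq_abs, abs_of_pos (ha0 n)]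
      rw [lt_div_iff₀ (ha0 n)] at hx
      show _ ≤ (1:ℝ)
      linarith
    simp [he, this]
  · have hb : ∀ n, eLpNorm (e n) p volume ≤ (ENNReal.ofReal ((2 / a n) ^ N) * volume (Metric.ball (0 : E N) 1)) ^ (p.toReal⁻¹) * ENNReal.ofReal C0 := by
      intro n
      rw [← hvol]
      refine eLpNorm_le_ball p (fun x => ?_) (hsup n)
      rw [he]; simp only [abs_mul]
      calc _ ≤ 1 * C0 := by gcongr; exacts [hchi _, hφ x]
        _ = C0 := one_mul _
    refine tendsto_of_tendsto_of_tendsto_of_le_of_le tendsto_const_nhds ?_ (fun _ => zero_le) hb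
    have l1 : Tendsto (fun n => ENNReal.ofReal ((2 / a n) ^ N)) atTop (𝓝 0) := by
      have := ENNReal.tendsto_ofReal (hat.pow N)
      simpa [show N ≠ 0 by omega] using this
    have l2 := ENNReal.Tendsto.mul_const (b := volume (Metric.ball (0 : E N) 1)) l1 (Or.inr measure_ball_lt_top.ne)
    have hpp : 0 < p.toReal⁻¹ := inv_pos.2 (ENNReal.toReal_pos hp0 hp)
    have l3 := (ENNReal.continuous_rpow_const (y := p.toReal⁻¹)).tendsto _ |>.comp l2
    have l4 := ENNReal.Tendsto.mul_const (b := ENNReal.ofReal C0) l3 (Or.inr ENNReal.ofReal_ne_top)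
    simpa [Function.comp_def, ENNReal.zero_rpow_of_pos hpp] using l4
  · set v := volume (Metric.ball (0 : E N) 1) with hv
    have hvt : v ≠ ⊤ := measure_ball_lt_top.ne
    have hb : ∀ᶠ n in atTop, eLpNorm (lapl (e n)) 2 volume ≤
        ENNReal.ofReal (Real.sqrt (32 / a n)) * (v ^ ((2:ℝ)⁻¹) * ENNReal.ofReal C) := by
      have : ∀ᶠ n in atTop, 2 / a n < 1 := hat.eventually_lt_const (by norm_num)
      filter_upwards [this] with n hn
      have q0 := ha0 n
      refine (eLpNorm_le_ball 2 (hl n) (hsupl n)).trans ?_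
      rw [hvol, ENNReal.toReal_ofNat, ENNReal.mul_rpow_of_nonneg _ _ (by norm_num)]
      have : ENNReal.ofReal ((2 / a n) ^ N) ≤ ENNReal.ofReal ((2 / a n) ^ 5) :=
        ENNReal.ofReal_le_ofReal (pow_le_pow_of_le_one (by positivity) hn.le hN)
      calc _ ≤ ENNReal.ofReal ((2 / a n) ^ 5) ^ ((2:ℝ)⁻¹) * v ^ ((2:ℝ)⁻¹) * ENNReal.ofReal (C * a n ^ 2) := by
            gcongr
        _ = ENNReal.ofReal (Real.sqrt ((2 / a n) ^ 5) * a n ^ 2) * (v ^ ((2:ℝ)⁻¹) * ENNReal.ofReal C) := by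
            rw [ENNReal.ofReal_rpow_of_nonneg (by positivity) (by norm_num), Real.sqrt_eq_rpow,
              ENNReal.ofReal_mul hC, ENNReal.ofReal_mul (by positivity)]
            norm_num
            ring
        _ = _ := by
            congr 2
            have : a n ^ 2 = Real.sqrt (a n ^ 4) := by
              rw [show a n ^ 4 = (a n ^ 2) ^ 2 by ring, Real.sqrt_sq (by positivity)]
            rw [this, ← Real.sqrt_mul (by positivity)]
            congr 1
            field_simp
            norm_num
    refine tendsto_of_tendsto_of_tendsto_of_le_of_le' tendsto_const_nhds ?_ (Eventually.of_forall fun _ => zero_le) hb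
    have l0 : Tendsto (fun n => 32 / a n) atTop (𝓝 0) :=
      tendsto_const_nhds.div_atTop (tendsto_natCast_atTop_atTop.atTop_add tendsto_const_nhds)
    have l1 := ENNReal.tendsto_ofReal ((Real.continuous_sqrt.tendsto 0).comp l0)
    have l2 := ENNReal.Tendsto.mul_const (b := v ^ ((2:ℝ)⁻¹) * ENNReal.ofReal C) l1
      (Or.inr (ENNReal.mul_ne_top (ENNReal.rpow_ne_top_of_nonneg (by norm_num) hvt) ENNReal.ofReal_ne_top))
    simpa [Function.comp_def] using l2

end

noncomputable section

lemma exists_conj {p : ℝ≥0∞} (hp : 1 ≤ p) : ∃ q : ℝ≥0∞, ENNReal.HolderConjugate p q := by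
  refine ⟨(1 - p⁻¹)⁻¹, ⟨?_⟩⟩
  rw [inv_inv, inv_one]
  exact add_tsub_cancel_of_le (ENNReal.inv_le_one.2 hp)

lemma holder_m {α : Type*} [MeasurableSpace α] {μ : Measure α} {p q : ℝ≥0∞}
    (hpq : ENNReal.HolderConjugate p q) {a b : α → ℝ} (ha : MemLp a p μ) (hb : MemLp b q μ) :
    MemLp (fun x => a x * b x) 1 μ := hb.mul' (p := p) (q := q) (hpqr := hpq) ha

lemma holder_nb {α : Type*} [MeasurableSpace α] {μ : Measure α} {p q : ℝ≥0∞}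
    (hpq : ENNReal.HolderConjugate p q) {a b : α → ℝ} (ha : MemLp a p μ) (hb : MemLp b q μ) :
    eLpNorm (fun x => a x * b x) 1 μ ≤ eLpNorm a p μ * eLpNorm b q μ := by
  have h := eLpNorm_smul_le_mul_eLpNorm (p := p) (q := q) (r := 1) (f := b) (φ := a) (μ := μ)
    (hpqr := hpq) hb.1 ha.1
  have e : (fun x => a x * b x) = a • b := rfl
  rw [e]
  exact h

lemma pairing_tendsto {α ι : Type*} [MeasurableSpace α] {μ : Measure α} {l : Filter ι} {p q : ℝ≥0∞}
    (hpq : ENNReal.HolderConjugate p q) {f : ι → α → ℝ} {f0 : α → ℝ} {g : ι → α → ℝ} {g0 : α → ℝ}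
    (hf : ∀ n, MemLp (f n) p μ) (hf0 : MemLp f0 p μ) (hg : ∀ n, MemLp (g n) q μ)
    (hg0 : MemLp g0 q μ)
    (h1 : Tendsto (fun n => eLpNorm (fun x => f n x - f0 x) p μ) l (𝓝 0))
    (h2 : Tendsto (fun n => eLpNorm (fun x => g n x - g0 x) q μ) l (𝓝 0)) :
    Tendsto (fun n => ∫ x, f n x * g n x ∂μ) l (𝓝 (∫ x, f0 x * g0 x ∂μ)) := by
  have m : ∀ {a b : α → ℝ}, MemLp a p μ → MemLp b q μ → MemLp (fun x => a x * b x) 1 μ :=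
    fun ha hb => holder_m hpq ha hb
  have nb : ∀ {a b : α → ℝ}, MemLp a p μ → MemLp b q μ →
      eLpNorm (fun x => a x * b x) 1 μ ≤ eLpNorm a p μ * eLpNorm b q μ :=
    fun ha hb => holder_nb hpq ha hb
  refine tendsto_integral_of_L1' _ (m hf0 hg0).1
    (Eventually.of_forall fun n => memLp_one_iff_integrable.1 (m (hf n) (hg n))) ?_
  have hb : ∀ n, eLpNorm ((fun x => f n x * g n x) - fun x => f0 x * g0 x) 1 μ ≤
      eLpNorm (fun x => f n x - f0 x) p μ * eLpNorm (fun x => g n x - g0 x) q μ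
      + eLpNorm (fun x => f n x - f0 x) p μ * eLpNorm g0 q μ
      + eLpNorm f0 p μ * eLpNorm (fun x => g n x - g0 x) q μ := by
    intro n
    have ef : MemLp (fun x => f n x - f0 x) p μ := (hf n).sub hf0
    have eg : MemLp (fun x => g n x - g0 x) q μ := (hg n).sub hg0
    have e : ((fun x => f n x * g n x) - fun x => f0 x * g0 x) =
        ((fun x => (f n x - f0 x) * (g n x - g0 x)) + fun x => (f n x - f0 x) * g0 x)
          + fun x => f0 x * (g n x - g0 x) := by
      ext x; simp only [Pi.sub_apply, Pi.add_apply]; ring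
    rw [e]
    refine (eLpNorm_add_le ((m ef eg).1.add (m ef hg0).1) (m hf0 eg).1 le_rfl).trans ?_
    gcongr
    · refine (eLpNorm_add_le (m ef eg).1 (m ef hg0).1 le_rfl).trans ?_
      gcongr
      · exact nb ef eg
      · exact nb ef hg0
    · exact nb hf0 eg
  refine tendsto_of_tendsto_of_tendsto_of_le_of_le tendsto_const_nhds ?_ (fun _ => zero_le) hb
  have t1 := ENNReal.Tendsto.mul h1 (Or.inr ENNReal.zero_ne_top) h2 (Or.inr ENNReal.zero_ne_top)
  have t2 := ENNReal.Tendsto.mul_const (b := eLpNorm g0 q μ) h1 (Or.inr hg0.2.ne)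
  have t3 := ENNReal.Tendsto.const_mul (a := eLpNorm f0 p μ) h2 (Or.inr hf0.2.ne)
  simpa using (t1.add t2).add t3

lemma eLpNorm_sub_tri {α : Type*} [MeasurableSpace α] {μ : Measure α} {p : ℝ≥0∞} (hp : 1 ≤ p)
    {a b c : α → ℝ} (ha : AEStronglyMeasurable a μ) (hb : AEStronglyMeasurable b μ)
    (hc : AEStronglyMeasurable c μ) :
    eLpNorm (fun x => a x - c x) p μ ≤
      eLpNorm (fun x => a x - b x) p μ + eLpNorm (fun x => b x - c x) p μ := by
  have e : (fun x => a x - c x) = (fun x => a x - b x) + (fun x => b x - c x) := by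
    ext x; simp
  rw [e]
  exact eLpNorm_add_le (ha.sub hb) (hb.sub hc) hp

lemma eLpNorm_sub_symm {α : Type*} [MeasurableSpace α] {μ : Measure α} {p : ℝ≥0∞}
    (a b : α → ℝ) : eLpNorm (fun x => a x - b x) p μ = eLpNorm (fun x => b x - a x) p μ :=
  eLpNorm_sub_comm a b p μ

lemma memD22_approx {N : ℕ} (hN : 5 ≤ N) {u w : E N → ℝ} (h : MemD22 N u w) {ε : ℝ≥0∞}
    (hε : 0 < ε) : ∃ φ, TF0 φ ∧ eLpNorm (fun x => φ x - u x) (twoSS N) volume < ε ∧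
      eLpNorm (fun x => lapl φ x - w x) 2 volume < ε := by
  obtain ⟨hu, hw, φ, hφ, h1, h2⟩ := h
  have hε2 : 0 < ε / 2 := ENNReal.half_pos hε.ne'
  obtain ⟨n, hn1, hn2⟩ := ((h1.eventually_lt_const hε2).and (h2.eventually_lt_const hε2)).exists
  have hT : TF (φ n) := hφ n
  obtain ⟨e, he, he0, e1, e2⟩ := cutoff_exists hN hT (twoSS_ne_zero hN) (twoSS_ne_top hN)
  obtain ⟨m, hm1, hm2⟩ := ((e1.eventually_lt_const hε2).and (e2.eventually_lt_const hε2)).exists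
  refine ⟨_, he0 m, ?_, ?_⟩
  · refine (eLpNorm_sub_tri (b := φ n) (one_le_twoSS hN) (hT.memLp 2 |>.1.sub ((he m).memLp 2).1) (hT.memLp 2).1 hu.1).trans_lt ?_
    rw [← ENNReal.add_halves ε]
    refine ENNReal.add_lt_add ?_ hn1
    rw [eLpNorm_sub_symm]
    simpa using hm1
  · have hs : lapl (fun x => φ n x - e m x) = fun x => lapl (φ n) x - lapl (e m) x := by
      ext x; exact lapl_sub hT (he m) x
    rw [hs]
    refine (eLpNorm_sub_tri (b := lapl (φ n)) (by norm_num) ((hT.lapl.memLp 2).1.sub ((he m).lapl.memLp 2).1) (hT.lapl.memLp 2).1 hw.1).trans_lt ?_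
    rw [← ENNReal.add_halves ε]
    refine ENNReal.add_lt_add ?_ hn2
    rw [eLpNorm_sub_symm]
    simpa using hm2

lemma memD22_of_approx {N : ℕ} {u w : E N → ℝ} (hu : MemLp u (twoSS N) volume)
    (hw : MemLp w 2 volume)
    (h : ∀ ε : ℝ≥0∞, 0 < ε → ∃ φ, TF φ ∧ eLpNorm (fun x => φ x - u x) (twoSS N) volume < ε ∧
      eLpNorm (fun x => lapl φ x - w x) 2 volume < ε) : MemD22 N u w := by
  have hp : ∀ n : ℕ, (0 : ℝ≥0∞) < ((n : ℝ≥0∞))⁻¹ := fun n => ENNReal.inv_pos.2 (natCast_ne_top n)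
  choose φ h1 h2 h3 using fun n : ℕ => h _ (hp n)
  refine ⟨hu, hw, φ, h1, ?_, ?_⟩
  · exact tendsto_of_tendsto_of_tendsto_of_le_of_le tendsto_const_nhds ENNReal.tendsto_inv_nat_nhds_zero
      (fun _ => zero_le) (fun n => (h2 n).le)
  · exact tendsto_of_tendsto_of_tendsto_of_le_of_le tendsto_const_nhds ENNReal.tendsto_inv_nat_nhds_zero
      (fun _ => zero_le) (fun n => (h3 n).le)

lemma memD22_seq {N : ℕ} (hN : 5 ≤ N) {u w : E N → ℝ} (h : MemD22 N u w) :
    ∃ φ : ℕ → E N → ℝ, (∀ n, TF0 (φ n)) ∧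
    Tendsto (fun n => eLpNorm (fun x => φ n x - u x) (twoSS N) volume) atTop (𝓝 0) ∧
    Tendsto (fun n => eLpNorm (fun x => lapl (φ n) x - w x) 2 volume) atTop (𝓝 0) := by
  have hp : ∀ n : ℕ, (0 : ℝ≥0∞) < ((n : ℝ≥0∞))⁻¹ := fun n => ENNReal.inv_pos.2 (natCast_ne_top n)
  choose φ h1 h2 h3 using fun n : ℕ => memD22_approx hN h (hp n)
  refine ⟨φ, h1, ?_, ?_⟩
  · exact tendsto_of_tendsto_of_tendsto_of_le_of_le tendsto_const_nhds ENNReal.tendsto_inv_nat_nhds_zero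
      (fun _ => zero_le) (fun n => (h2 n).le)
  · exact tendsto_of_tendsto_of_tendsto_of_le_of_le tendsto_const_nhds ENNReal.tendsto_inv_nat_nhds_zero
      (fun _ => zero_le) (fun n => (h3 n).le)

lemma memD22_limit {N : ℕ} (hN : 5 ≤ N) {u w : E N → ℝ} {un wn : ℕ → E N → ℝ}
    (h : ∀ n, MemD22 N (un n) (wn n))
    (hu : MemLp u (twoSS N) volume) (hw : MemLp w 2 volume)
    (h1 : Tendsto (fun n => eLpNorm (fun x => un n x - u x) (twoSS N) volume) atTop (𝓝 0))
    (h2 : Tendsto (fun n => eLpNorm (fun x => wn n x - w x) 2 volume) atTop (𝓝 0)) :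
    MemD22 N u w := by
  refine memD22_of_approx hu hw fun ε hε => ?_
  have hε2 : 0 < ε / 2 := ENNReal.half_pos hε.ne'
  obtain ⟨n, hn1, hn2⟩ := ((h1.eventually_lt_const hε2).and (h2.eventually_lt_const hε2)).exists
  obtain ⟨φ, hφ, a1, a2⟩ := memD22_approx hN (h n) hε2
  refine ⟨φ, hφ.1, ?_, ?_⟩
  · refine (eLpNorm_sub_tri (b := un n) (one_le_twoSS hN) (hφ.1.memLp 2).1 (h n).1.1 hu.1).trans_lt ?_
    rw [← ENNReal.add_halves ε]
    exact ENNReal.add_lt_add a1 hn1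
  · refine (eLpNorm_sub_tri (b := wn n) (by norm_num) (hφ.1.lapl.memLp 2).1 (h n).2.1.1 hw.1).trans_lt ?_
    rw [← ENNReal.add_halves ε]
    exact ENNReal.add_lt_add a2 hn2

lemma MemD22.congr {N : ℕ} {u w u' w' : E N → ℝ} (h : MemD22 N u w) (h1 : u =ᵐ[volume] u')
    (h2 : w =ᵐ[volume] w') : MemD22 N u' w' := by
  obtain ⟨hu, hw, φ, hφ, t1, t2⟩ := h
  refine ⟨hu.ae_eq h1, hw.ae_eq h2, φ, hφ, ?_, ?_⟩
  · refine t1.congr fun n => eLpNorm_congr_ae ?_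
    filter_upwards [h1] with x hx; rw [hx]
  · refine t2.congr fun n => eLpNorm_congr_ae ?_
    filter_upwards [h2] with x hx; rw [hx]

lemma MemD22.add {N : ℕ} (hN : 5 ≤ N) {u w u' w' : E N → ℝ} (h : MemD22 N u w)
    (h' : MemD22 N u' w') : MemD22 N (fun x => u x + u' x) (fun x => w x + w' x) := by
  refine memD22_of_approx (h.1.add h'.1) (h.2.1.add h'.2.1) fun ε hε => ?_
  have hε2 : 0 < ε / 2 := ENNReal.half_pos hε.ne'
  obtain ⟨φ, hφ, a1, a2⟩ := memD22_approx hN h hε2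
  obtain ⟨ψ, hψ, b1, b2⟩ := memD22_approx hN h' hε2
  refine ⟨_, hφ.1.add hψ.1, ?_, ?_⟩
  · have e : (fun x => φ x + ψ x - (u x + u' x)) = (fun x => φ x - u x) + fun x => ψ x - u' x := by
      ext x; simp only [Pi.add_apply]; ring
    rw [e, ← ENNReal.add_halves ε]
    exact (eLpNorm_add_le ((hφ.1.memLp 2).1.sub h.1.1) ((hψ.1.memLp 2).1.sub h'.1.1)
      (one_le_twoSS hN)).trans_lt (ENNReal.add_lt_add a1 b1)
  · have e : (fun x => lapl (fun x => φ x + ψ x) x - (w x + w' x)) = (fun x => lapl φ x - w x) + fun x => lapl ψ x - w' x := by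
      ext x; simp only [Pi.add_apply]; rw [lapl_add hφ.1 hψ.1]; ring
    rw [e, ← ENNReal.add_halves ε]
    exact (eLpNorm_add_le ((hφ.1.lapl.memLp 2).1.sub h.2.1.1) ((hψ.1.lapl.memLp 2).1.sub h'.2.1.1)
      (by norm_num)).trans_lt (ENNReal.add_lt_add a2 b2)

lemma MemD22.const_mul {N : ℕ} {u w : E N → ℝ} (h : MemD22 N u w) (c : ℝ) :
    MemD22 N (fun x => c * u x) (fun x => c * w x) := by
  obtain ⟨hu, hw, φ, hφ, t1, t2⟩ := h
  refine ⟨hu.const_mul c, hw.const_mul c, fun n x => c * φ n x, fun n => TF.const_mul (hφ n) c, ?_, ?_⟩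
  · have e : ∀ n, eLpNorm (fun x => c * φ n x - c * u x) (twoSS N) volume = ‖c‖ₑ * eLpNorm (fun x => φ n x - u x) (twoSS N) volume := by
      intro n
      rw [← eLpNorm_const_smul]
      congr 1; ext x; simp [mul_sub]
    simp only [e]
    simpa using ENNReal.Tendsto.const_mul (a := ‖c‖ₑ) t1 (Or.inr (by simp))
  · have e : ∀ n, eLpNorm (fun x => lapl (fun x => c * φ n x) x - c * w x) 2 volume = ‖c‖ₑ * eLpNorm (fun x => lapl (φ n) x - w x) 2 volume := by
      intro n
      rw [← eLpNorm_const_smul]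
      congr 1; ext x; simp [mul_sub, lapl_const_mul (hφ n)]
    simp only [e]
    simpa using ENNReal.Tendsto.const_mul (a := ‖c‖ₑ) t2 (Or.inr (by simp))

lemma MemD22.weak {N : ℕ} (hN : 5 ≤ N) {u w : E N → ℝ} (h : MemD22 N u w) {φ : E N → ℝ} (hφ : TF φ) :
    ∫ x, w x * φ x = ∫ x, u x * lapl φ x := by
  obtain ⟨hu, hw, ψ, hψ, t1, t2⟩ := h
  obtain ⟨q, hq⟩ := exists_conj (one_le_twoSS hN)
  have hψT : ∀ n, TF (ψ n) := hψ
  have l1 := pairing_tendsto (p := 2) (q := 2) inferInstance (g := fun _ => φ) (g0 := φ) (fun n => (hψT n).lapl.memLp 2) hw (fun _ => hφ.memLp 2) (hφ.memLp 2) t2 (by simp)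
  have l2 := pairing_tendsto (p := twoSS N) (q := q) hq (g := fun _ => lapl φ) (g0 := lapl φ) (fun n => (hψT n).memLp _) hu (fun _ => hφ.lapl.memLp q) (hφ.lapl.memLp q) t1 (by simp)
  refine tendsto_nhds_unique l1 (l2.congr fun n => ?_)
  exact (integral_lapl_mul (hψT n) hφ).symm

lemma MemD22.unique {N : ℕ} (hN : 5 ≤ N) {u w w' : E N → ℝ} (h : MemD22 N u w)
    (h' : MemD22 N u w') : w =ᵐ[volume] w' := by
  refine ae_eq_of_integral_contDiff_smul_eq (h.2.1.locallyIntegrable (by norm_num))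
    (h'.2.1.locallyIntegrable (by norm_num)) fun g hg hgc => ?_
  have hT : TF g := ⟨hg, hgc⟩
  simp only [smul_eq_mul, mul_comm (g _)]
  rw [h.weak hN hT, h'.weak hN hT]

end

noncomputable section

/-- Restriction of a function to the ray through `ω`, extended radially. -/
def ray {N : ℕ} (ω : Sph N) {β : Type*} (h : E N → β) (x : E N) : β := h (‖x‖ • (ω : E N))

lemma ray_radial {N : ℕ} (ω : Sph N) (h : E N → ℝ) : IsRadial (ray ω h) := by
  intro x y hxy; simp only [ray, hxy]

lemma norm_sph {N : ℕ} (ω : Sph N) : ‖(ω : E N)‖ = 1 := norm_eq_of_mem_sphere ω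

lemma norm_ray {N : ℕ} (ω : Sph N) (x : E N) : ‖‖x‖ • (ω : E N)‖ = ‖x‖ := by
  simp [norm_smul]

lemma IsRadial.ray_eq {N : ℕ} {u : E N → ℝ} (h : IsRadial u) (ω : Sph N) : ray ω u = u := by
  ext x; exact h _ _ (norm_ray ω x)

lemma ray_aemeas {N : ℕ} (hN : 5 ≤ N) {F : E N → ℝ≥0∞} (hF : AEMeasurable F volume) :
    AEMeasurable (fun q : Sph N × E N => F (rayMap N q)) ((Psph N).prod volume) :=
  hF.comp_quasiMeasurePreserving (rayMap_mp hN).quasiMeasurePreserving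

lemma ray_lintegral {N : ℕ} (hN : 5 ≤ N) {F : E N → ℝ≥0∞} (hF : AEMeasurable F volume) :
    ∫⁻ ω, (∫⁻ x, ray ω F x) ∂(Psph N) = ∫⁻ x, F x := by
  have := prob_Psph hN
  have h1 := lintegral_prod _ (ray_aemeas hN hF)
  have h2 : ∫⁻ q, F (rayMap N q) ∂((Psph N).prod volume) = ∫⁻ x, F x := by
    conv_rhs => rw [← (rayMap_mp hN).map_eq]
    rw [lintegral_map' (by rw [(rayMap_mp hN).map_eq]; exact hF) (continuous_rayMap N).aemeasurable]
  rw [← h2, h1]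
  rfl

lemma ray_lintegral_meas {N : ℕ} (hN : 5 ≤ N) {F : E N → ℝ≥0∞} (hF : AEMeasurable F volume) :
    AEMeasurable (fun ω => ∫⁻ x, ray ω F x) (Psph N) :=
  (ray_aemeas hN hF).lintegral_prod_right'

lemma ray_aesm {N : ℕ} (hN : 5 ≤ N) {g : E N → ℝ} (hg : AEStronglyMeasurable g volume) :
    ∀ᵐ ω ∂(Psph N), AEStronglyMeasurable (ray ω g) volume := by
  have := prob_Psph hN
  have h1 : AEStronglyMeasurable (fun q => g (rayMap N q)) ((Psph N).prod volume) :=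
    hg.comp_measurePreserving (rayMap_mp hN)
  exact h1.prodMk_left

lemma ray_memLp {N : ℕ} (hN : 5 ≤ N) {g : E N → ℝ} {p : ℝ≥0∞} (hp0 : p ≠ 0) (hp : p ≠ ⊤)
    (hg : MemLp g p volume) : ∀ᵐ ω ∂(Psph N), MemLp (ray ω g) p volume := by
  have hF : AEMeasurable (fun x => ‖g x‖ₑ ^ p.toReal) volume := hg.1.enorm.pow_const _
  have hfin := hg.2
  rw [eLpNorm_lt_top_iff_lintegral_rpow_enorm_lt_top hp0 hp, ← ray_lintegral hN hF] at hfin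
  filter_upwards [ae_lt_top' (ray_lintegral_meas hN hF) hfin.ne, ray_aesm hN hg.1] with ω h1 h2
  refine ⟨h2, ?_⟩
  rw [eLpNorm_lt_top_iff_lintegral_rpow_enorm_lt_top hp0 hp]
  exact h1

lemma exists_seq_ae_zero {Ω : Type*} [MeasurableSpace Ω] {μ : Measure Ω} {G : ℕ → Ω → ℝ≥0∞}
    (hG : ∀ n, AEMeasurable (G n) μ) (h : Tendsto (fun n => ∫⁻ ω, G n ω ∂μ) atTop (𝓝 0)) :
    ∃ ns : ℕ → ℕ, ∀ᵐ ω ∂μ, Tendsto (fun k => G (ns k) ω) atTop (𝓝 0) := by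
  have hpos : ∀ k : ℕ, (0 : ℝ≥0∞) < (1/2) ^ k := fun k => by
    apply ENNReal.pow_pos; simp
  choose ns hns using fun k : ℕ => (h.eventually_lt_const (hpos k)).exists
  refine ⟨ns, ?_⟩
  have hs : ∫⁻ ω, ∑' k, G (ns k) ω ∂μ ≠ ⊤ := by
    rw [lintegral_tsum fun k => hG _]
    refine ne_top_of_le_ne_top ?_ (ENNReal.tsum_le_tsum fun k => (hns k).le)
    rw [ENNReal.tsum_geometric]
    simp
  filter_upwards [ae_lt_top' (AEMeasurable.tsum fun k => hG (ns k)) hs] with ω hω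
  exact ENNReal.tendsto_atTop_zero_of_tsum_ne_top hω.ne

lemma tendsto_eLpNorm_iff {α : Type*} [MeasurableSpace α] {μ : Measure α} {p : ℝ≥0∞}
    (hp0 : p ≠ 0) (hp : p ≠ ⊤) {g : ℕ → α → ℝ} :
    Tendsto (fun n => eLpNorm (g n) p μ) atTop (𝓝 0) ↔
    Tendsto (fun n => ∫⁻ x, ‖g n x‖ₑ ^ p.toReal ∂μ) atTop (𝓝 0) := by
  have hpp : 0 < p.toReal := ENNReal.toReal_pos hp0 hp
  constructor
  · intro h
    have := ((ENNReal.continuous_rpow_const (y := p.toReal)).tendsto 0).comp h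
    rw [ENNReal.zero_rpow_of_pos hpp] at this
    refine this.congr fun n => ?_
    simp only [Function.comp]
    rw [eLpNorm_eq_lintegral_rpow_enorm_toReal hp0 hp, ← ENNReal.rpow_mul]
    simp [hpp.ne']
  · intro h
    have := ((ENNReal.continuous_rpow_const (y := 1 / p.toReal)).tendsto 0).comp h
    rw [ENNReal.zero_rpow_of_pos (by positivity)] at this
    refine this.congr fun n => ?_
    simp only [Function.comp]
    rw [eLpNorm_eq_lintegral_rpow_enorm_toReal hp0 hp]

lemma rayLap_eLpNorm {N : ℕ} (hN : 5 ≤ N) : ∃ C : ℝ≥0∞, C ≠ ⊤ ∧ ∀ φ : E N → ℝ, TF0 φ →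
    eLpNorm (rayLap φ) 2 volume ≤ C * eLpNorm (lapl φ) 2 volume := by
  set c : ℝ := 2 + 2 * ((N : ℝ) - 1) ^ 2 with hc
  have hc0 : 0 ≤ c := by positivity
  refine ⟨ENNReal.ofReal (c ^ (1/2 : ℝ)), ENNReal.ofReal_ne_top, fun φ hφ => ?_⟩
  have key : ∀ {g : E N → ℝ}, TF g → eLpNorm g 2 volume = ENNReal.ofReal ((∫ x, g x ^ 2) ^ (1/2 : ℝ)) := by
    intro g hg
    rw [(hg.memLp 2).eLpNorm_eq_integral_rpow_norm (by norm_num) (by norm_num)]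
    simp
  rw [key (rayLap_TF0 hφ).1, key hφ.1.lapl, ← ENNReal.ofReal_mul (by positivity),
    ← Real.mul_rpow hc0 (integral_nonneg fun x => by positivity)]
  refine ENNReal.ofReal_le_ofReal (Real.rpow_le_rpow (integral_nonneg fun x => by positivity) ?_ (by norm_num))
  exact rayLap_bound (by omega) hφ

lemma ray_main {N : ℕ} (hN : 5 ≤ N) {h z : E N → ℝ} (hh : MemD22 N h z) :
    ∃ (φ : ℕ → E N → ℝ) (ζ : E N → ℝ), (∀ n, TF0 (φ n)) ∧ MemLp ζ 2 volume ∧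
    Tendsto (fun n => eLpNorm (fun x => lapl (φ n) x - z x) 2 volume) atTop (𝓝 0) ∧
    Tendsto (fun n => eLpNorm (fun x => rayLap (φ n) x - ζ x) 2 volume) atTop (𝓝 0) ∧
    ∀ᵐ ω ∂(Psph N), MemD22 N (ray ω h) (ray ω ζ) ∧ ∃ ψ : ℕ → E N → ℝ,
      (∀ k, TF0 (ψ k) ∧ IsRadial (ψ k)) ∧
      Tendsto (fun k => eLpNorm (fun x => lapl (ψ k) x - ray ω ζ x) 2 volume) atTop (𝓝 0) := by
  have hpos : ∀ k : ℕ, (0 : ℝ≥0∞) < (1/2) ^ k := fun k => by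
    apply ENNReal.pow_pos; simp
  choose φ hφ a1 a2 using fun n : ℕ => memD22_approx hN hh (hpos n)
  have hlim : Tendsto (fun k : ℕ => (1/2 : ℝ≥0∞) ^ k) atTop (𝓝 0) :=
    ENNReal.tendsto_pow_atTop_nhds_zero_of_lt_one (by simp)
  have t1 : Tendsto (fun n => eLpNorm (fun x => φ n x - h x) (twoSS N) volume) atTop (𝓝 0) :=
    tendsto_of_tendsto_of_tendsto_of_le_of_le tendsto_const_nhds hlim (fun _ => zero_le) (fun n => (a1 n).le)
  have t2 : Tendsto (fun n => eLpNorm (fun x => lapl (φ n) x - z x) 2 volume) atTop (𝓝 0) :=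
    tendsto_of_tendsto_of_tendsto_of_le_of_le tendsto_const_nhds hlim (fun _ => zero_le) (fun n => (a2 n).le)
  obtain ⟨C, hC, hCb⟩ := rayLap_eLpNorm hN
  obtain ⟨ζ, hζ, t3⟩ : ∃ ζ, MemLp ζ 2 volume ∧
      Tendsto (fun n => eLpNorm (rayLap (φ n) - ζ) 2 volume) atTop (𝓝 0) := by
    refine Lp.cauchy_complete_eLpNorm (by norm_num) (fun n => (rayLap_TF0 (hφ n)).1.memLp 2)
      (B := fun n => (C + 1) * ((1/2) ^ n + (1/2) ^ n)) ?_ ?_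
    · rw [ENNReal.tsum_mul_left, ENNReal.tsum_add, ENNReal.tsum_geometric]
      refine ENNReal.mul_ne_top (ENNReal.add_ne_top.2 ⟨hC, by simp⟩) (by simp)
    · intro k n m hn hm
      have e1 : rayLap (φ n) - rayLap (φ m) = rayLap (fun x => φ n x - φ m x) := by
        ext x; simp [rayLap_sub (hφ n).1 (hφ m).1]
      have e2 : lapl (fun x => φ n x - φ m x) = fun x => lapl (φ n) x - lapl (φ m) x := by
        ext x; exact lapl_sub (hφ n).1 (hφ m).1 x
      have mono : ∀ {n}, k ≤ n → ((1/2 : ℝ≥0∞)) ^ n ≤ (1/2) ^ k := fun h =>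
        pow_le_pow_of_le_one zero_le (by simp) h
      have e3 : eLpNorm (fun x => lapl (φ n) x - lapl (φ m) x) 2 volume < (1/2) ^ k + (1/2) ^ k := by
        refine (eLpNorm_sub_tri (b := z) (by norm_num) ((hφ n).1.lapl.memLp 2).1 hh.2.1.1
          ((hφ m).1.lapl.memLp 2).1).trans_lt ?_
        refine ENNReal.add_lt_add ((a2 n).trans_le (mono hn)) ?_
        rw [eLpNorm_sub_symm]
        exact (a2 m).trans_le (mono hm)
      rw [e1]
      refine (hCb _ ((hφ n).sub (hφ m))).trans_lt ?_
      rw [e2]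
      calc _ ≤ (C + 1) * eLpNorm (fun x => lapl (φ n) x - lapl (φ m) x) 2 volume := by
            gcongr; exact le_self_add
        _ < _ := ENNReal.mul_lt_mul_right (by simp) (ENNReal.add_ne_top.2 ⟨hC, by simp⟩) e3
  refine ⟨φ, ζ, hφ, hζ, t2, t3, ?_⟩
  have hp0 := twoSS_ne_zero hN
  have hp := twoSS_ne_top hN
  have t1' := (tendsto_eLpNorm_iff hp0 hp).1 t1
  have t3' := (tendsto_eLpNorm_iff (by norm_num) (by norm_num)).1 t3
  set F1 : ℕ → E N → ℝ≥0∞ := fun n x => ‖φ n x - h x‖ₑ ^ (twoSS N).toReal with hF1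
  set F2 : ℕ → E N → ℝ≥0∞ := fun n x => ‖rayLap (φ n) x - ζ x‖ₑ ^ (2 : ℝ≥0∞).toReal with hF2
  have m1 : ∀ n, AEMeasurable (F1 n) volume := fun n =>
    (((hφ n).1.memLp 2).1.sub hh.1.1).enorm.pow_const _
  have m2 : ∀ n, AEMeasurable (F2 n) volume := fun n =>
    (((rayLap_TF0 (hφ n)).1.memLp 2).1.sub hζ.1).enorm.pow_const _
  have hG := exists_seq_ae_zero (μ := Psph N) (G := fun n ω => (∫⁻ x, ray ω (F1 n) x) + ∫⁻ x, ray ω (F2 n) x)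
    (fun n => (ray_lintegral_meas hN (m1 n)).add (ray_lintegral_meas hN (m2 n))) (by
      have := t1'.add t3'
      rw [add_zero] at this
      refine this.congr fun n => ?_
      rw [lintegral_add_left' (ray_lintegral_meas hN (m1 n)), ray_lintegral hN (m1 n), ray_lintegral hN (m2 n)]
      rfl)
  obtain ⟨ns, hns⟩ := hG
  filter_upwards [hns, ray_memLp hN hp0 hp hh.1, ray_memLp hN (by norm_num) (by norm_num) hζ] with ω hω b1 b2
  have s1 : Tendsto (fun k => ∫⁻ x, ray ω (F1 (ns k)) x) atTop (𝓝 0) :=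
    tendsto_of_tendsto_of_tendsto_of_le_of_le tendsto_const_nhds hω (fun _ => zero_le) (fun n => le_self_add)
  have s2 : Tendsto (fun k => ∫⁻ x, ray ω (F2 (ns k)) x) atTop (𝓝 0) :=
    tendsto_of_tendsto_of_tendsto_of_le_of_le tendsto_const_nhds hω (fun _ => zero_le) (fun n => le_add_self)
  set ψ : ℕ → E N → ℝ := fun k => ray ω (φ (ns k)) with hψ
  have hψT : ∀ k, TF0 (ψ k) := fun k => ray_TF0 (hφ (ns k)) (norm_sph ω)
  have hψl : ∀ k x, lapl (ψ k) x = ray ω (rayLap (φ (ns k))) x := fun k x =>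
    lapl_ray (hφ (ns k)) (norm_sph ω) x
  have r1 : Tendsto (fun k => eLpNorm (fun x => ψ k x - ray ω h x) (twoSS N) volume) atTop (𝓝 0) :=
    (tendsto_eLpNorm_iff hp0 hp).2 s1
  have r2 : Tendsto (fun k => eLpNorm (fun x => lapl (ψ k) x - ray ω ζ x) 2 volume) atTop (𝓝 0) := by
    simp only [hψl]
    exact (tendsto_eLpNorm_iff (by norm_num) (by norm_num)).2 s2
  exact ⟨⟨b1, b2, ψ, fun k => (hψT k).1, r1, r2⟩, ψ, fun k => ⟨hψT k, ray_radial _ _⟩, r2⟩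

end

noncomputable section

lemma ray_integrable {N : ℕ} (hN : 5 ≤ N) {g : E N → ℝ} (hg : Integrable g) :
    Integrable (fun q => g (rayMap N q)) ((Psph N).prod volume) :=
  (rayMap_mp hN).integrable_comp_of_integrable hg

lemma ray_integral {N : ℕ} (hN : 5 ≤ N) {g : E N → ℝ} (hg : Integrable g) :
    ∫ ω, (∫ x, ray ω g x) ∂(Psph N) = ∫ x, g x := by
  have := prob_Psph hN
  have h1 := integral_prod _ (ray_integrable hN hg)
  have h2 : ∫ q, g (rayMap N q) ∂((Psph N).prod volume) = ∫ x, g x := by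
    conv_rhs => rw [← (rayMap_mp hN).map_eq]
    rw [integral_map (continuous_rayMap N).aemeasurable (by rw [(rayMap_mp hN).map_eq]; exact hg.1)]
  rw [← h2, h1]
  rfl

lemma TF0.lapl {N : ℕ} {φ : E N → ℝ} (h : TF0 φ) : TF0 (lapl φ) := by
  refine ⟨h.1.lapl, ?_⟩
  obtain ⟨h1, δ, hδ, h2⟩ := h
  refine ⟨δ, hδ, fun x hx => ?_⟩
  rw [lapl_eq]
  exact Finset.sum_eq_zero fun i _ => pd_zero_near (pd_zero_near h2 i) i x hx

lemma snd_mp {N : ℕ} (hN : 5 ≤ N) :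
    MeasurePreserving (fun q : Sph N × E N => q.2) ((Psph N).prod volume) volume := by
  have := prob_Psph hN
  exact measurePreserving_snd

lemma snd_memLp {N : ℕ} (hN : 5 ≤ N) {g : E N → ℝ} {p : ℝ≥0∞} (hg : MemLp g p volume) :
    MemLp (fun q : Sph N × E N => g q.2) p ((Psph N).prod volume) :=
  hg.comp_measurePreserving (snd_mp hN)

lemma rayMap_memLp {N : ℕ} (hN : 5 ≤ N) {g : E N → ℝ} {p : ℝ≥0∞} (hg : MemLp g p volume) :
    MemLp (fun q : Sph N × E N => g (rayMap N q)) p ((Psph N).prod volume) :=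
  hg.comp_measurePreserving (rayMap_mp hN)

lemma smooth_pairing {N : ℕ} (hN : 5 ≤ N) {ρ φ : E N → ℝ} (hρ : TF0 ρ) (hr : IsRadial ρ)
    (hφ : TF0 φ) :
    ∫ q, ρ q.2 * rayLap φ (rayMap N q) ∂((Psph N).prod volume) = ∫ x, ρ x * lapl φ x := by
  have := prob_Psph hN
  have hi : Integrable (fun q : Sph N × E N => ρ q.2 * rayLap φ (rayMap N q)) ((Psph N).prod volume) :=
    memLp_one_iff_integrable.1 (holder_m (p := 2) (q := 2) inferInstance
      (snd_memLp hN (hρ.1.memLp 2)) (rayMap_memLp hN ((rayLap_TF0 hφ).1.memLp 2)))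
  rw [integral_prod _ hi, ← integral_lapl_mul hρ.1 hφ.1,
    ← ray_integral hN (g := fun x => lapl ρ x * φ x) (hρ.1.lapl.mul hφ.1.1).integrable]
  refine integral_congr_ae (Eventually.of_forall fun ω => ?_)
  have e1 : ∀ x, rayLap φ (rayMap N (ω, x)) = lapl (ray ω φ) x := fun x =>
    (lapl_ray hφ (norm_sph ω) x).symm
  simp only [e1]
  have hrT : TF (ray ω φ) := (ray_TF0 hφ (norm_sph ω)).1
  rw [← integral_lapl_mul hρ.1 hrT]
  refine integral_congr_ae (Eventually.of_forall fun x => ?_)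
  simp only [ray]
  rw [lapl_radial hρ hr _ x (norm_ray ω x)]

lemma radial_approx {N : ℕ} (hN : 5 ≤ N) {u w : E N → ℝ} (hu : MemD22 N u w) (hr : IsRadial u) :
    ∃ ψ : ℕ → E N → ℝ, (∀ k, TF0 (ψ k) ∧ IsRadial (ψ k)) ∧
      Tendsto (fun k => eLpNorm (fun x => lapl (ψ k) x - w x) 2 volume) atTop (𝓝 0) := by
  have := prob_Psph hN
  obtain ⟨φ, ζ, -, -, -, -, h⟩ := ray_main hN hu
  obtain ⟨ω, h1, ψ, h2, h3⟩ := h.exists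
  rw [hr.ray_eq ω] at h1
  refine ⟨ψ, h2, h3.congr fun k => eLpNorm_congr_ae ?_⟩
  filter_upwards [h1.unique hN hu] with x hx
  rw [hx]

lemma ray_pairing_integrable {N : ℕ} (hN : 5 ≤ N) {w ζ : E N → ℝ} (hw : MemLp w 2 volume)
    (hζ : MemLp ζ 2 volume) : Integrable (fun q : Sph N × E N => w q.2 * ζ (rayMap N q)) ((Psph N).prod volume) :=
  memLp_one_iff_integrable.1 (holder_m (p := 2) (q := 2) inferInstance
      (snd_memLp hN hw) (rayMap_memLp hN hζ))

lemma ray_pairing {N : ℕ} (hN : 5 ≤ N) {u w : E N → ℝ} (hu : MemD22 N u w) (hr : IsRadial u)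
    {z ζ : E N → ℝ} {φ : ℕ → E N → ℝ} (hφ : ∀ n, TF0 (φ n)) (hz : MemLp z 2 volume)
    (hζ : MemLp ζ 2 volume)
    (t1 : Tendsto (fun n => eLpNorm (fun x => lapl (φ n) x - z x) 2 volume) atTop (𝓝 0))
    (t2 : Tendsto (fun n => eLpNorm (fun x => rayLap (φ n) x - ζ x) 2 volume) atTop (𝓝 0)) :
    ∫ q, w q.2 * ζ (rayMap N q) ∂((Psph N).prod volume) = ∫ x, w x * z x := by
  obtain ⟨ψ, h1, h2⟩ := radial_approx hN hu hr
  have hw := hu.2.1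
  have l1 := pairing_tendsto (p := 2) (q := 2) inferInstance
    (f := fun k => lapl (ψ k)) (g := fun k => lapl (φ k))
    (fun n => (h1 n).1.1.lapl.memLp 2) hw (fun n => (hφ n).1.lapl.memLp 2) hz h2 t1
  have l2 := pairing_tendsto (p := 2) (q := 2) (μ := (Psph N).prod volume) inferInstance
    (f := fun k q => lapl (ψ k) q.2) (f0 := fun q => w q.2)
    (g := fun k q => rayLap (φ k) (rayMap N q)) (g0 := fun q => ζ (rayMap N q))
    (fun n => snd_memLp hN ((h1 n).1.1.lapl.memLp 2)) (snd_memLp hN hw)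
    (fun n => rayMap_memLp hN ((rayLap_TF0 (hφ n)).1.memLp 2)) (rayMap_memLp hN hζ)
    (h2.congr fun n => (eLpNorm_comp_measurePreserving (((h1 n).1.1.lapl.memLp 2).1.sub hw.1) (snd_mp hN)).symm)
    (t2.congr fun n => (eLpNorm_comp_measurePreserving (((rayLap_TF0 (hφ n)).1.memLp 2).1.sub hζ.1) (rayMap_mp hN)).symm)
  refine tendsto_nhds_unique l2 (l1.congr fun n => ?_)
  exact (smooth_pairing hN (h1 n).1.lapl (lapl_radial (h1 n).1 (h1 n).2) (hφ n)).symm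

end

noncomputable section

lemma subseq_ae {α : Type*} [MeasurableSpace α] {μ : Measure α} {p : ℝ≥0∞} (hp : p ≠ 0)
    {f : ℕ → α → ℝ} {g : α → ℝ} (hf : ∀ n, AEStronglyMeasurable (f n) μ)
    (hg : AEStronglyMeasurable g μ)
    (h : Tendsto (fun n => eLpNorm (fun x => f n x - g x) p μ) atTop (𝓝 0)) :
    ∃ ns : ℕ → ℕ, StrictMono ns ∧ ∀ᵐ x ∂μ, Tendsto (fun k => f (ns k) x) atTop (𝓝 (g x)) :=
  (tendstoInMeasure_of_tendsto_eLpNorm hp hf hg h).exists_seq_tendsto_ae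

/-- The weighted measure `V(|x|) dx`. -/
def muV (N : ℕ) (V : ℝ → ℝ≥0∞) : Measure (E N) := volume.withDensity (fun x => V ‖x‖)

lemma muV_ac (N : ℕ) (V : ℝ → ℝ≥0∞) : muV N V ≪ volume := withDensity_absolutelyContinuous _ _

lemma muV_lintegral {N : ℕ} {V : ℝ → ℝ≥0∞} (hV : Measurable V) {u : E N → ℝ}
    (hu : AEStronglyMeasurable u volume) :
    ∫⁻ x, ‖u x‖ₑ ^ (2:ℝ) ∂(muV N V) = ∫⁻ x, V ‖x‖ * ENNReal.ofReal (u x ^ 2) := by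
  have hVm : Measurable (fun x : E N => V ‖x‖) := hV.comp measurable_norm
  rw [muV, lintegral_withDensity_eq_lintegral_mul₀ hVm.aemeasurable
    (hu.enorm.pow_const _)]
  refine lintegral_congr fun x => ?_
  simp only [Pi.mul_apply]
  congr 1
  rw [Real.enorm_eq_ofReal_abs, ENNReal.ofReal_rpow_of_nonneg (abs_nonneg _) (by norm_num)]
  norm_num


lemma memLp_muV {N : ℕ} {V : ℝ → ℝ≥0∞} (hV : Measurable V) {u : E N → ℝ}
    (hu : AEStronglyMeasurable u volume) :
    MemLp u 2 (muV N V) ↔ (∫⁻ x : E N, V ‖x‖ * ENNReal.ofReal ((u x) ^ 2)) < ⊤ := by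
  rw [← muV_lintegral hV hu]
  have h := eLpNorm_lt_top_iff_lintegral_rpow_enorm_lt_top (f := u) (μ := muV N V) (p := 2)
    (by norm_num) (by norm_num)
  simp only [ENNReal.toReal_ofNat] at h
  rw [← h]
  exact ⟨fun h => h.2, fun h => ⟨hu.mono_ac (muV_ac N V), h⟩⟩

lemma radial_limit {N : ℕ} {f : ℕ → E N → ℝ} (hf : ∀ n, IsRadial (f n)) :
    IsRadial (fun x => limUnder atTop (fun k => f k x)) := by
  intro x y hxy
  have : (fun k => f k x) = fun k => f k y := funext fun k => hf k x y hxy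
  simp only [this]

/-- The Hilbert-type space of radial functions, realised in a product of `L^p` spaces. -/
def XSub (N : ℕ) (hN : 5 ≤ N) (V : ℝ → ℝ≥0∞) (hV : Measurable V) :
    Submodule ℝ (Lp ℝ (twoSS N) (volume : Measure (E N)) × Lp ℝ 2 (volume : Measure (E N)) ×
      Lp ℝ 2 (muV N V)) where
  carrier := {x | ∃ h z : E N → ℝ, MemH2Vr V h z ∧ x.1 =ᵐ[volume] h ∧ x.2.1 =ᵐ[volume] z ∧
    x.2.2 =ᵐ[muV N V] h}
  add_mem' := by
    rintro x y ⟨h, z, ⟨⟨m1, m2⟩, m3⟩, a1, a2, a3⟩ ⟨h', z', ⟨⟨m1', m2'⟩, m3'⟩, b1, b2, b3⟩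
    refine ⟨fun x => h x + h' x, fun x => z x + z' x, ⟨⟨m1.add hN m1', ?_⟩, ?_⟩, ?_, ?_, ?_⟩
    · have := (((memLp_muV hV m1.1.1).2 m2).add ((memLp_muV hV m1'.1.1).2 m2'))
      exact (memLp_muV hV (m1.1.1.add m1'.1.1)).1 this
    · intro p q hpq
      simp only [m3 p q hpq, m3' p q hpq]
    · filter_upwards [a1, b1, Lp.coeFn_add x.1 y.1] with t c1 c2 c3
      simp only [Prod.fst_add, c3, Pi.add_apply, c1, c2]
    · filter_upwards [a2, b2, Lp.coeFn_add x.2.1 y.2.1] with t c1 c2 c3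
      simp only [Prod.fst_add, Prod.snd_add, c3, Pi.add_apply, c1, c2]
    · filter_upwards [a3, b3, Lp.coeFn_add x.2.2 y.2.2] with t c1 c2 c3
      simp only [Prod.snd_add, c3, Pi.add_apply, c1, c2]
  zero_mem' := by
    have hz : lapl (fun _ : E N => (0:ℝ)) = fun _ => 0 := by
      ext x; simp [lapl]
    refine ⟨fun _ => 0, fun _ => 0, ⟨⟨⟨MemLp.zero', MemLp.zero', fun _ _ => 0, fun n => ⟨contDiff_const, HasCompactSupport.zero⟩, by simp, by simp [hz]⟩, by simp⟩, fun _ _ _ => rfl⟩, ?_, ?_, ?_⟩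
    · exact Lp.coeFn_zero _ _ _
    · exact Lp.coeFn_zero _ _ _
    · exact Lp.coeFn_zero _ _ _
  smul_mem' := by
    rintro c x ⟨h, z, ⟨⟨m1, m2⟩, m3⟩, a1, a2, a3⟩
    refine ⟨fun x => c * h x, fun x => c * z x, ⟨⟨m1.const_mul c, ?_⟩, ?_⟩, ?_, ?_, ?_⟩
    · have := ((memLp_muV hV m1.1.1).2 m2).const_mul c
      exact (memLp_muV hV (m1.1.1.const_mul c)).1 this
    · intro p q hpq
      simp only [m3 p q hpq]
    · filter_upwards [a1, Lp.coeFn_smul c x.1] with t c1 c3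
      simp only [Prod.smul_fst, c3, Pi.smul_apply, c1, smul_eq_mul]
    · filter_upwards [a2, Lp.coeFn_smul c x.2.1] with t c1 c3
      simp only [Prod.smul_fst, Prod.smul_snd, c3, Pi.smul_apply, c1, smul_eq_mul]
    · filter_upwards [a3, Lp.coeFn_smul c x.2.2] with t c1 c3
      simp only [Prod.smul_snd, c3, Pi.smul_apply, c1, smul_eq_mul]

lemma XSub_closed {N : ℕ} (hN : 5 ≤ N) {V : ℝ → ℝ≥0∞} (hV : Measurable V)
    [Fact (1 ≤ twoSS N)] :
    IsClosed (XSub N hN V hV : Set (Lp ℝ (twoSS N) (volume : Measure (E N)) × Lp ℝ 2 (volume : Measure (E N)) ×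
      Lp ℝ 2 (muV N V))) := by
  refine IsSeqClosed.isClosed fun x y hx hxy => ?_
  have l1 : Tendsto (fun n => (x n).1) atTop (𝓝 y.1) := (continuous_fst.tendsto _).comp hxy
  have l2 : Tendsto (fun n => (x n).2.1) atTop (𝓝 y.2.1) :=
    ((continuous_fst.comp continuous_snd).tendsto _).comp hxy
  have l3 : Tendsto (fun n => (x n).2.2) atTop (𝓝 y.2.2) :=
    ((continuous_snd.comp continuous_snd).tendsto _).comp hxy
  rw [Lp.tendsto_Lp_iff_tendsto_eLpNorm'] at l1 l2 l3
  choose h z hm a1 a2 a3 using hx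
  have t1 : Tendsto (fun n => eLpNorm (fun t => h n t - y.1 t) (twoSS N) volume) atTop (𝓝 0) := by
    refine l1.congr fun n => eLpNorm_congr_ae ?_
    filter_upwards [a1 n] with t ht
    simp [ht]
  have t2 : Tendsto (fun n => eLpNorm (fun t => z n t - y.2.1 t) 2 volume) atTop (𝓝 0) := by
    refine l2.congr fun n => eLpNorm_congr_ae ?_
    filter_upwards [a2 n] with t ht
    simp [ht]
  have t3 : Tendsto (fun n => eLpNorm (fun t => h n t - y.2.2 t) 2 (muV N V)) atTop (𝓝 0) := by
    refine l3.congr fun n => eLpNorm_congr_ae ?_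
    filter_upwards [a3 n] with t ht
    simp [ht]
  have hsm : ∀ n, AEStronglyMeasurable (h n) volume := fun n => (hm n).1.1.1.1
  obtain ⟨ns, hns, c1⟩ := subseq_ae (twoSS_ne_zero hN) hsm (Lp.memLp y.1).1 t1
  set H : E N → ℝ := fun t => limUnder atTop (fun k => h (ns k) t) with hH
  have e1 : y.1 =ᵐ[volume] H := by
    filter_upwards [c1] with t ht
    exact ht.limUnder_eq.symm
  obtain ⟨ms, hms, c2⟩ := subseq_ae (by norm_num) (fun k => (hsm (ns k)).mono_ac (muV_ac N V)) (Lp.memLp y.2.2).1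
    (t3.comp hns.tendsto_atTop)
  have e3 : y.2.2 =ᵐ[muV N V] H := by
    filter_upwards [c2, (muV_ac N V).ae_le c1] with t h1 h2
    have h3 := h2.comp hms.tendsto_atTop
    rw [tendsto_nhds_unique h1 h3]
    exact h2.limUnder_eq.symm
  have hHm : MemLp H (twoSS N) volume := (Lp.memLp y.1).ae_eq e1
  refine ⟨H, y.2.1, ⟨⟨?_, ?_⟩, radial_limit fun k => (hm (ns k)).2⟩, e1, EventuallyEq.rfl, e3⟩
  · refine memD22_limit hN (fun n => (hm n).1.1) hHm (Lp.memLp y.2.1) ?_ t2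
    refine t1.congr fun n => eLpNorm_congr_ae ?_
    filter_upwards [e1] with t ht
    rw [ht]
  · exact (memLp_muV hV hHm.1).1 ((Lp.memLp y.2.2).ae_eq e3)

end

noncomputable section

lemma abstract_cg {α X : Type*} [MeasurableSpace α] {μ : Measure α} {p : ℝ≥0∞} [Fact (1 ≤ p)]
    [NormedAddCommGroup X] [NormedSpace ℝ X] [CompleteSpace X] (ι : X →L[ℝ] Lp ℝ p μ)
    {κ : α → ℝ} (hm : ∀ x : X, MemLp (fun t => κ t * ι x t) 1 μ) :
    ∃ C : ℝ≥0∞, C ≠ ⊤ ∧ ∀ x : X, ∫⁻ t, ‖κ t * ι x t‖ₑ ∂μ ≤ C * ‖x‖ₑ := by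
  have hp : p ≠ 0 := (lt_of_lt_of_le one_pos (Fact.out : 1 ≤ p)).ne'
  let T : X →ₗ[ℝ] Lp ℝ 1 μ :=
    { toFun := fun x => (hm x).toLp _
      map_add' := fun x y => by
        refine Lp.ext ?_
        filter_upwards [(hm (x + y)).coeFn_toLp, (hm x).coeFn_toLp, (hm y).coeFn_toLp,
          Lp.coeFn_add ((hm x).toLp _) ((hm y).toLp _), Lp.coeFn_add (ι x) (ι y)] with t b1 b2 b3 b4 b5
        rw [b1, b4, Pi.add_apply, b2, b3, map_add, b5, Pi.add_apply]
        ring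
      map_smul' := fun c x => by
        refine Lp.ext ?_
        filter_upwards [(hm (c • x)).coeFn_toLp, (hm x).coeFn_toLp,
          Lp.coeFn_smul c ((hm x).toLp _), Lp.coeFn_smul c (ι x)] with t b1 b2 b4 b5
        rw [b1]
        simp only [RingHom.id_apply]
        rw [b4, Pi.smul_apply, b2, map_smul, b5, Pi.smul_apply, smul_eq_mul, smul_eq_mul]
        ring }
  have hTc : ∀ x, T x =ᵐ[μ] fun t => κ t * ι x t := fun x => (hm x).coeFn_toLp
  have hTn : ∀ x, ‖T x‖ₑ = ∫⁻ t, ‖κ t * ι x t‖ₑ ∂μ := fun x => by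
    have : ‖T x‖ₑ = ‖(hm x).toLp _‖ₑ := rfl
    rw [this, Lp.enorm_toLp, eLpNorm_one_eq_lintegral_enorm]
  clear_value T
  have hT : Continuous T := by
    refine LinearMap.continuous_of_seq_closed_graph T fun x y w hx hw => ?_
    have l1 : Tendsto (fun n => ι (x n)) atTop (𝓝 (ι y)) := (ι.continuous.tendsto _).comp hx
    rw [Lp.tendsto_Lp_iff_tendsto_eLpNorm'] at l1 hw
    obtain ⟨ns, hns, c1⟩ := subseq_ae (f := fun n => (ι (x n) : α → ℝ)) (g := (ι y : α → ℝ)) hp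
      (fun n => (Lp.memLp (ι (x n))).1) (Lp.memLp (ι y)).1 l1
    obtain ⟨ms, hms, c2⟩ := subseq_ae (f := fun n => (T (x (ns n)) : α → ℝ)) (g := (w : α → ℝ)) one_ne_zero
      (fun n => (Lp.memLp (T (x (ns n)))).1) (Lp.memLp w).1
      (hw.comp hns.tendsto_atTop)
    have c3 : ∀ᵐ t ∂μ, ∀ n, (T (x n) : α → ℝ) t = κ t * ι (x n) t :=
      ae_all_iff.2 fun n => hTc (x n)
    refine Lp.ext ?_
    filter_upwards [c1, c2, c3, hTc y] with t d1 d2 d3 d4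
    rw [d4]
    refine tendsto_nhds_unique d2 ?_
    simp only [d3]
    exact ((d1.comp hms.tendsto_atTop).const_mul (κ t))
  let TL : X →L[ℝ] Lp ℝ 1 μ := ⟨T, hT⟩
  refine ⟨ENNReal.ofReal ‖TL‖, ENNReal.ofReal_ne_top, fun x => ?_⟩
  rw [← hTn, ← ofReal_norm, ← ofReal_norm, ← ENNReal.ofReal_mul (norm_nonneg _)]
  exact ENNReal.ofReal_le_ofReal (TL.le_opNorm x)

lemma closed_graph_bound {N : ℕ} (hN : 5 ≤ N) {V : ℝ → ℝ≥0∞} (hV : Measurable V) {κ : E N → ℝ}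
    (hInt : ∀ h z : E N → ℝ, MemH2Vr V h z → Integrable (fun x => κ x * h x)) :
    ∃ C : ℝ≥0∞, C ≠ ⊤ ∧ ∀ h z : E N → ℝ, MemH2Vr V h z →
      ∫⁻ x, ‖κ x * h x‖ₑ ≤ C * (eLpNorm h (twoSS N) volume + eLpNorm z 2 volume
        + eLpNorm h 2 (muV N V)) := by
  have hf : Fact (1 ≤ twoSS N) := ⟨one_le_twoSS hN⟩
  have hXc := XSub_closed (N := N) hN hV
  have : CompleteSpace (XSub N hN V hV) := IsClosed.completeSpace_coe (hs := hXc)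
  let ι : (XSub N hN V hV) →L[ℝ] Lp ℝ (twoSS N) (volume : Measure (E N)) :=
    (ContinuousLinearMap.fst ℝ _ _).comp (XSub N hN V hV).subtypeL
  have hι : ∀ x, ι x = x.1.1 := fun x => rfl
  clear_value ι
  have hm : ∀ x, MemLp (fun t => κ t * ι x t) 1 (volume : Measure (E N)) := by
    intro x
    obtain ⟨h, z, hh, a1, -, -⟩ := x.2
    refine memLp_one_iff_integrable.2 ((hInt h z hh).congr ?_)
    filter_upwards [a1] with t ht
    rw [hι, ht]
  obtain ⟨C, hC, hb⟩ := abstract_cg ι hm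
  refine ⟨C, hC, fun h z hh => ?_⟩
  have m1 : MemLp h (twoSS N) volume := hh.1.1.1
  have m2 : MemLp z 2 volume := hh.1.1.2.1
  have m3 : MemLp h 2 (muV N V) := (memLp_muV hV m1.1).2 hh.1.2
  obtain ⟨x, hx⟩ : ∃ x : XSub N hN V hV, x.1 = (m1.toLp h, m2.toLp z, m3.toLp h) :=
    ⟨⟨(m1.toLp h, m2.toLp z, m3.toLp h), h, z, hh, m1.coeFn_toLp, m2.coeFn_toLp, m3.coeFn_toLp⟩, rfl⟩
  have e1 : ∫⁻ t, ‖κ t * ι x t‖ₑ = ∫⁻ t, ‖κ t * h t‖ₑ := by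
    refine lintegral_congr_ae ?_
    rw [hι, hx]
    filter_upwards [m1.coeFn_toLp] with t ht
    simp only [ht]
  have e2 : ‖x‖ₑ ≤ eLpNorm h (twoSS N) volume + eLpNorm z 2 volume + eLpNorm h 2 (muV N V) := by
    have n0 : ‖x‖ ≤ ‖m1.toLp h‖ + ‖m2.toLp z‖ + ‖m3.toLp h‖ := by
      have hn : ‖x‖ = ‖x.1‖ := rfl
      rw [hn, hx, Prod.norm_def, Prod.norm_def]
      have p1 := norm_nonneg (m1.toLp h)
      have p2 := norm_nonneg (m2.toLp z)
      have p3 := norm_nonneg (m3.toLp h)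
      refine max_le (by linarith) (max_le (by linarith) (by linarith))
    rw [← Lp.enorm_toLp m1, ← Lp.enorm_toLp m2, ← Lp.enorm_toLp m3]
    simp only [← ofReal_norm]
    rw [← ENNReal.ofReal_add (norm_nonneg _) (norm_nonneg _), ← ENNReal.ofReal_add (by positivity) (norm_nonneg _)]
    exact ENNReal.ofReal_le_ofReal n0
  rw [← e1]
  exact (hb x).trans (by gcongr)

end

noncomputable section

lemma eLpNorm_le_one_add {α : Type*} [MeasurableSpace α] {μ : Measure α} {p : ℝ≥0∞} (h1 : 1 ≤ p)
    (hp : p ≠ ⊤) (f : α → ℝ) : eLpNorm f p μ ≤ 1 + ∫⁻ x, ‖f x‖ₑ ^ p.toReal ∂μ := by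
  have hp0 : p ≠ 0 := (lt_of_lt_of_le one_pos h1).ne'
  rw [eLpNorm_eq_lintegral_rpow_enorm_toReal hp0 hp]
  have hr : 1 ≤ p.toReal := by
    rw [← ENNReal.toReal_one]; exact (ENNReal.toReal_le_toReal one_ne_top hp).2 h1
  set a := ∫⁻ x, ‖f x‖ₑ ^ p.toReal ∂μ
  rcases le_total a 1 with h | h
  · exact (ENNReal.rpow_le_one h (by positivity)).trans le_self_add
  · calc a ^ (1 / p.toReal) ≤ a ^ (1:ℝ) := ENNReal.rpow_le_rpow_of_exponent_le h (by
          rw [div_le_one (by linarith)]; exact hr)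
      _ = a := ENNReal.rpow_one a
      _ ≤ _ := le_add_self

lemma V_integrable {N : ℕ} {V : ℝ → ℝ≥0∞} (hV : Measurable V) {u w h z : E N → ℝ}
    (hu : MemH2V V u w) (hh : MemH2V V h z) :
    Integrable (fun x => (V ‖x‖).toReal * u x * h x) := by
  have hVm : Measurable (fun x : E N => V ‖x‖) := hV.comp measurable_norm
  refine ⟨(hVm.ennreal_toReal.aestronglyMeasurable.mul hu.1.1.1).mul hh.1.1.1, ?_⟩
  have hb : ∀ x : E N, ‖(V ‖x‖).toReal * u x * h x‖ₑ ≤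
      V ‖x‖ * ENNReal.ofReal (u x ^ 2) + V ‖x‖ * ENNReal.ofReal (h x ^ 2) := fun x => by
    rw [mul_assoc, enorm_mul, ← mul_add, ← ENNReal.ofReal_add (sq_nonneg _) (sq_nonneg _)]
    refine mul_le_mul' ?_ ?_
    · rw [Real.enorm_eq_ofReal ENNReal.toReal_nonneg]
      exact ENNReal.ofReal_toReal_le
    · rw [Real.enorm_eq_ofReal_abs]
      refine ENNReal.ofReal_le_ofReal (abs_le.2 ⟨?_, ?_⟩) <;> nlinarith [sq_nonneg (u x + h x), sq_nonneg (u x - h x)]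
  have hm : AEMeasurable (fun x : E N => V ‖x‖ * ENNReal.ofReal (u x ^ 2)) volume :=
    hVm.aemeasurable.mul (hu.1.1.1.aemeasurable.pow_const 2).ennreal_ofReal
  refine lt_of_le_of_lt (lintegral_mono hb) ?_
  rw [lintegral_add_left' hm]
  exact ENNReal.add_lt_top.2 ⟨hu.2, hh.2⟩

lemma ray_MemH2Vr {N : ℕ} (hN : 5 ≤ N) {V : ℝ → ℝ≥0∞} (hV : Measurable V) {h z ζ : E N → ℝ}
    (hh : MemH2V V h z) (hr : ∀ᵐ ω ∂(Psph N), MemD22 N (ray ω h) (ray ω ζ)) :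
    ∀ᵐ ω ∂(Psph N), MemH2Vr V (ray ω h) (ray ω ζ) := by
  have hVm : Measurable (fun x : E N => V ‖x‖) := hV.comp measurable_norm
  have hm : AEMeasurable (fun x : E N => V ‖x‖ * ENNReal.ofReal (h x ^ 2)) volume :=
    hVm.aemeasurable.mul (hh.1.1.1.aemeasurable.pow_const 2).ennreal_ofReal
  have hfin := hh.2
  rw [← ray_lintegral hN hm] at hfin
  filter_upwards [hr, ae_lt_top' (ray_lintegral_meas hN hm) hfin.ne] with ω h1 h2
  refine ⟨⟨h1, ?_⟩, ray_radial ω h⟩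
  simp only [ray, norm_ray] at h2
  exact h2

lemma K_integrable {N : ℕ} (hN : 5 ≤ N) {V : ℝ → ℝ≥0∞} (hV : Measurable V) {h z ζ κ : E N → ℝ}
    (hh : MemH2V V h z) (hζ : MemLp ζ 2 volume)
    (hr : ∀ᵐ ω ∂(Psph N), MemH2Vr V (ray ω h) (ray ω ζ))
    (hκm : AEStronglyMeasurable κ volume) (hκ : IsRadial κ)
    (hInt : ∀ h z : E N → ℝ, MemH2Vr V h z → Integrable (fun x => κ x * h x)) :
    Integrable (fun x => κ x * h x) := by
  have := prob_Psph hN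
  have hhm := hh.1.1.1
  obtain ⟨C, hC, hb⟩ := closed_graph_bound hN hV hInt
  refine ⟨hκm.mul hhm, ?_⟩
  have hVm : Measurable (fun x : E N => V ‖x‖) := hV.comp measurable_norm
  set F1 : E N → ℝ≥0∞ := fun x => ‖h x‖ₑ ^ (twoSS N).toReal with hF1
  set F2 : E N → ℝ≥0∞ := fun x => ‖ζ x‖ₑ ^ (2:ℝ) with hF2
  set F3 : E N → ℝ≥0∞ := fun x => V ‖x‖ * ENNReal.ofReal (h x ^ 2) with hF3
  have m1 : AEMeasurable F1 volume := hhm.enorm.pow_const _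
  have m2 : AEMeasurable F2 volume := hζ.1.enorm.pow_const _
  have m3 : AEMeasurable F3 volume :=
    hVm.aemeasurable.mul (hhm.aemeasurable.pow_const 2).ennreal_ofReal
  have i1 : ∫⁻ x, F1 x < ⊤ :=
    (eLpNorm_lt_top_iff_lintegral_rpow_enorm_lt_top (twoSS_ne_zero hN) (twoSS_ne_top hN)).1 hh.1.1.2
  have i2 : ∫⁻ x, F2 x < ⊤ := by
    have := (eLpNorm_lt_top_iff_lintegral_rpow_enorm_lt_top (p := 2) (by norm_num) (by norm_num)).1 hζ.2
    simpa only [ENNReal.toReal_ofNat] using this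
  have i3 : ∫⁻ x, F3 x < ⊤ := hh.2
  have hm0 : AEMeasurable (fun x => ‖κ x * h x‖ₑ) volume := (hκm.mul hhm).enorm
  have key : ∀ᵐ ω ∂(Psph N), ∫⁻ x, ray ω (fun x => ‖κ x * h x‖ₑ) x ≤
      C * (3 + ((∫⁻ x, ray ω F1 x) + (∫⁻ x, ray ω F2 x) + (∫⁻ x, ray ω F3 x))) := by
    filter_upwards [hr] with ω hω
    have e0 : ∀ x, ray ω (fun x => ‖κ x * h x‖ₑ) x = ‖κ x * ray ω h x‖ₑ := fun x => by
      simp only [ray]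
      rw [hκ _ x (norm_ray ω x)]
    simp only [e0]
    refine (hb _ _ hω).trans ?_
    refine mul_le_mul' le_rfl ?_
    have b1 := eLpNorm_le_one_add (μ := volume) (one_le_twoSS hN) (twoSS_ne_top hN) (ray ω h)
    have b2 := eLpNorm_le_one_add (μ := volume) (p := 2) (by norm_num) (by norm_num) (ray ω ζ)
    have b3 := eLpNorm_le_one_add (μ := muV N V) (p := 2) (by norm_num) (by norm_num) (ray ω h)
    simp only [ENNReal.toReal_ofNat] at b2 b3
    rw [muV_lintegral hV hω.1.1.1.1] at b3
    have e3 : ∀ x, ray ω F3 x = V ‖x‖ * ENNReal.ofReal (ray ω h x ^ 2) := fun x => by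
      simp only [ray, hF3, norm_ray]
    have e3' : ∫⁻ x, ray ω F3 x = ∫⁻ x, V ‖x‖ * ENNReal.ofReal (ray ω h x ^ 2) := lintegral_congr e3
    rw [e3']
    refine (add_le_add (add_le_add b1 b2) b3).trans (le_of_eq ?_)
    simp only [hF1, hF2, ray]
    ring
  change ∫⁻ x, ‖κ x * h x‖ₑ < ⊤
  rw [← ray_lintegral hN hm0]
  refine lt_of_le_of_lt (lintegral_mono_ae key) ?_
  rw [lintegral_const_mul' _ _ hC, lintegral_add_left measurable_const,
    lintegral_add_left' (f := fun ω => (∫⁻ x, ray ω F1 x) + (∫⁻ x, ray ω F2 x)) ((ray_lintegral_meas hN m1).add (ray_lintegral_meas hN m2)),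
    lintegral_add_left' (ray_lintegral_meas hN m1), ray_lintegral hN m1, ray_lintegral hN m2,
    ray_lintegral hN m3]
  refine ENNReal.mul_lt_top hC.lt_top (ENNReal.add_lt_top.2 ⟨by simp, ?_⟩)
  exact ENNReal.add_lt_top.2 ⟨ENNReal.add_lt_top.2 ⟨i1, i2⟩, i3⟩

/-- Integration over rays of a product `κ h` with radial `κ`. -/
lemma ray_mul {N : ℕ} (hN : 5 ≤ N) {κ h : E N → ℝ} (hκ : IsRadial κ)
    (hi : Integrable (fun x => κ x * h x)) :
    Integrable (fun ω => ∫ x, κ x * ray ω h x) (Psph N) ∧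
    ∫ ω, (∫ x, κ x * ray ω h x) ∂(Psph N) = ∫ x, κ x * h x := by
  have := prob_Psph hN
  have e : ∀ ω : Sph N, ∀ x, κ x * ray ω h x = ray ω (fun x => κ x * h x) x := fun ω x => by
    simp only [ray]
    rw [hκ _ x (norm_ray ω x)]
  simp only [e]
  exact ⟨(ray_integrable hN hi).integral_prod_left, ray_integral hN hi⟩

end

/-- Lemma 7.1, symmetric criticality: under `(V)`, `(K)` with
`s > 2N/(N+4)`, `(Q)`, `(f_{q₁,q₂})` and `(R'_{q₁,q₂})`, every critical point of
`I : H²_{V,r} → ℝ` (i.e. every `u ∈ H²_{V,r}` for which the Euler identity holds against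
all radial test functions) is a weak solution of
`Δ²u + V(|x|)u = K(|x|)f(u) + Q(|x|)`, i.e. the identity holds against all `h ∈ H²_V`. -/
theorem stmt17 (N : ℕ) (hN : 5 ≤ N) (V : ℝ → ℝ≥0∞) (K Q : ℝ → ℝ) (s : ℝ)
    (hV : HypV V) (hK : HypK K s) (hs : 2*(N:ℝ)/(N+4) < s) (hQ : HypQ N V Q)
    (f : ℝ → ℝ) (hf : Continuous f) (hf0 : f 0 = 0)
    (q1 q2 : ℝ) (hq1 : 1 < q1) (hq2 : 1 < q2) (hfg : Hypf f q1 q2)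
    (hR0 : ∃ R1 > (0:ℝ), R0 N V K q1 R1 < ⊤)
    (hRinf : ∃ R2 > (0:ℝ), Rinf N V K q2 R2 < ⊤)
    (u w : E N → ℝ) (hu : MemH2Vr V u w)
    (hcrit : ∀ h z : E N → ℝ, MemH2Vr V h z → EulerEq N V K Q f u w h z) :
    ∀ h z : E N → ℝ, MemH2V V h z → EulerEq N V K Q f u w h z := by
  intro h z hh
  have := prob_Psph hN
  obtain ⟨φ, ζ, hφ, hζ, t1, t2, hray⟩ := ray_main hN hh.1
  have hr : ∀ᵐ ω ∂(Psph N), MemH2Vr V (ray ω h) (ray ω ζ) :=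
    ray_MemH2Vr hN hV.1 hh (hray.mono fun ω hω => hω.1)
  have hκm : AEStronglyMeasurable (fun x : E N => K ‖x‖ * f (u x)) volume :=
    (hK.2.1.comp measurable_norm).aestronglyMeasurable.mul
      (hf.comp_aestronglyMeasurable hu.1.1.1.1)
  have hκ : IsRadial (fun x : E N => K ‖x‖ * f (u x)) := fun x y hxy => by
    simp only [hxy, hu.2 x y hxy]
  have hκV : IsRadial (fun x : E N => (V ‖x‖).toReal * u x) := fun x y hxy => by
    simp only [hxy, hu.2 x y hxy]
  have hκQ : IsRadial (fun x : E N => Q ‖x‖) := fun x y hxy => by simp only [hxy]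
  have iW : Integrable (fun x => w x * z x) := memLp_one_iff_integrable.1
    (holder_m (p := 2) (q := 2) inferInstance hu.1.1.2.1 hh.1.2.1)
  have iV := V_integrable hV.1 hu.1 hh
  have iK : Integrable (fun x => K ‖x‖ * f (u x) * h x) :=
    K_integrable hN hV.1 hh hζ hr hκm hκ fun h' z' hm => (hcrit h' z' hm).2.2.1
  obtain ⟨L, -, hL⟩ := hQ.2.2
  have iQ : Integrable (fun x => Q ‖x‖ * h x) := (hL h z hh).1
  refine ⟨iW, iV, iK, iQ, ?_⟩
  obtain ⟨jV, eV⟩ := ray_mul hN hκV iV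
  obtain ⟨jK, eK⟩ := ray_mul hN hκ iK
  obtain ⟨jQ, eQ⟩ := ray_mul hN hκQ iQ
  have pi := ray_pairing_integrable hN hu.1.1.2.1 hζ
  have eW := ray_pairing hN hu.1.1 hu.2 hφ hh.1.2.1 hζ t1 t2
  rw [integral_prod _ pi] at eW
  have jW := pi.integral_prod_left
  rw [← eW, ← eV, ← eK, ← eQ, ← integral_add jW jV, ← integral_add jK jQ]
  refine integral_congr_ae ?_
  filter_upwards [hr] with ω hω
  exact (hcrit _ _ hω).2.2.2.2
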